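/- arXiv:math/0701489 — 8 statements merged into one kernel-verified Lean document; each statement's English description precedes it below -/
import Mathlib

section
/- Let n, p be positive integers, let λ₁, …, λ_p be nonzero real numbers, let E¹, …, E^p be antisymmetric real n×n matrices that are orthonormal in the sense that (1/2)·Σ_{a,b} Eⁱ_{ab} Eʲ_{ab} = δ^{ij}, and set D_i := −λ_i·Eⁱ. Suppose there are real constants Fʲ_{ik} such that [D_i, D_k] = Σ_j Fʲ_{ik}·D_j and such that for all i, k, a, b one has Σ_c (Eⁱ_{ac}·(D_k)_{cb} − Eⁱ_{bc}·(D_k)_{ca}) = Σ_j Fⁱ_{kj}·Eʲ_{ab}. Then the diagonal matrix β = diag(λ₁,…,λ_p) is invariant, i.e. for all i, j, l: λ_i·Fⁱ_{jl} + λ_l·Fˡ_{ji} = 0. -/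
open Matrix BigOperators

/-- Matrices that are orthonormal for half the Frobenius form are linearly independent. -/
theorem linearIndependent_of_half_frobenius_orthonormal {ι m n : Type*} [Fintype ι]
    [DecidableEq ι] [Fintype m] [Fintype n] (E : ι → Matrix m n ℝ)
    (horth : ∀ i j, (1/2 : ℝ) * ∑ a, ∑ b, E i a b * E j a b = if i = j then 1 else 0) :
    LinearIndependent ℝ E := by
  rw [Fintype.linearIndependent_iff]
  intro c hc i
  have hentry (a : m) (b : n) : ∑ j, c j * E j a b = 0 := by
    simpa [Matrix.sum_apply] using congrFun (congrFun hc a) b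
  calc
    c i = ∑ j, c j * ((1/2 : ℝ) * ∑ a, ∑ b, E i a b * E j a b) := by
      simp only [horth]
      simp
    _ = (1/2 : ℝ) * ∑ a, ∑ b, E i a b * ∑ j, c j * E j a b := by
      simp only [Finset.mul_sum]
      rw [Finset.sum_comm]
      refine Finset.sum_congr rfl fun a _ => ?_
      rw [Finset.sum_comm]
      refine Finset.sum_congr rfl fun b _ => Finset.sum_congr rfl fun j _ => ?_
      ring
    _ = 0 := by simp [hentry]

/-- The invariance of the matrix `β = diag(λ₁,…,λ_p)` under the holonomy algebra
of a symmetric space: `λ_i F^i_{jl} + λ_l F^l_{ji} = 0`. -/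
theorem beta_invariant
    (n p : ℕ) (hn : 0 < n) (hp : 0 < p)
    (lam : Fin p → ℝ) (hlam : ∀ i, lam i ≠ 0)
    (E : Fin p → Matrix (Fin n) (Fin n) ℝ)
    (hanti : ∀ i, (E i)ᵀ = -(E i))
    (horth : ∀ i j, (1/2 : ℝ) * ∑ a, ∑ b, E i a b * E j a b = if i = j then 1 else 0)
    (D : Fin p → Matrix (Fin n) (Fin n) ℝ)
    (hD : ∀ i, D i = -(lam i) • E i)
    (F : Fin p → Fin p → Fin p → ℝ)
    (hcomm : ∀ i k, D i * D k - D k * D i = ∑ j, F j i k • D j)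
    (hsym : ∀ i k a b, ∑ c, (E i a c * D k c b - E i b c * D k c a) = ∑ j, F i k j * E j a b) :
    ∀ i j l, lam i * F i j l + lam l * F l j i = 0 := by
  have hindep := linearIndependent_of_half_frobenius_orthonormal E horth
  have hbracket (i k : Fin p) : E i * D k - D k * E i = ∑ j, F i k j • E j := by
    have htranspose : (E i * D k)ᵀ = D k * E i := by
      simp [Matrix.transpose_mul, hD, hanti]
    rw [← htranspose]
    ext a b
    simpa [-Matrix.transpose_mul, Matrix.sum_apply, Matrix.mul_apply, Finset.sum_sub_distrib]
      using hsym i k a b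
  intro i j l
  refine Fintype.linearIndependent_iff.mp hindep
    (fun l => lam i * F i j l + lam l * F l j i) ?_ l
  have hfirst : ∑ l, (lam i * F i j l) • E l = D j * D i - D i * D j := by
    simp only [mul_smul, ← Finset.smul_sum, ← hbracket, hD i]
    simp [smul_sub, neg_add_eq_sub]
  have hsecond : ∑ l, (lam l * F l j i) • E l = -(D j * D i - D i * D j) := by
    rw [hcomm, ← Finset.sum_neg_distrib]
    refine Finset.sum_congr rfl fun l _ => ?_
    rw [hD l, neg_smul, smul_neg, neg_neg, smul_smul, mul_comm]
  simp only [add_smul, Finset.sum_add_distrib, hfirst, hsecond, add_neg_cancel]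
end

section
/- Let n, p be positive integers, λ₁, …, λ_p nonzero real numbers, E¹, …, E^p antisymmetric real n×n matrices, D_i := −λ_i Eⁱ, and Fʲ_{ik} real constants satisfying λ_i·Fⁱ_{jl} + λ_l·Fˡ_{ji} = 0 for all i,j,l. Define the combined structure constants C^A{}_{BC} on the index set {1,…,n} ⊔ {1,…,p} by Cⁱ_{ab} = Eⁱ_{ab}, C^a_{ib} = −C^a_{bi} = (D_i)_{ab}, Cⁱ_{kl} = Fⁱ_{kl}, all other components zero, and the diagonal (n+p)×(n+p) matrix γ = diag(1,…,1, λ₁,…,λ_p). Then γ is invariant under the curvature algebra: for all indices A, C, D one has γ_{AA}·C^A{}_{CD} + γ_{DD}·C^D{}_{CA} = 0 (no summation over A and D); equivalently, each matrix C_A with entries (C_A)^B{}_C = C^B{}_{AC} satisfies (C_A)ᵀ = −γ · C_A · γ⁻¹, and in particular each C_A is traceless. -/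
open Matrix BigOperators

/-- If `M` is skew-adjoint for the diagonal form with invertible weights `γ`, then
`Mᵀ = -γ M γ⁻¹`. -/
theorem transpose_eq_neg_diagonal_conj {ι K : Type*} [Fintype ι] [DecidableEq ι] [Field K]
    {γ : ι → K} (hγ : ∀ i, γ i ≠ 0) {M : Matrix ι ι K}
    (hM : ∀ i j, γ i * M i j + γ j * M j i = 0) :
    Mᵀ = -(Matrix.diagonal γ * M * (Matrix.diagonal γ)⁻¹) := by
  have hinv : (Matrix.diagonal γ)⁻¹ = Matrix.diagonal fun i => (γ i)⁻¹ := by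
    apply Matrix.inv_eq_right_inv
    simp [Matrix.diagonal_mul_diagonal, hγ]
  ext i j
  rw [hinv, Matrix.neg_apply, Matrix.mul_diagonal, Matrix.diagonal_mul, Matrix.transpose_apply]
  have hj := hγ j
  field_simp
  linear_combination hM i j

/-- A matrix that is skew-adjoint for a diagonal form with nonzero weights is traceless. -/
theorem trace_eq_zero_of_skew_diagonal {ι K : Type*} [Fintype ι] [Field K] [CharZero K]
    {γ : ι → K} (hγ : ∀ i, γ i ≠ 0) {M : Matrix ι ι K}
    (hM : ∀ i j, γ i * M i j + γ j * M j i = 0) : M.trace = 0 :=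
  Finset.sum_eq_zero fun i _ =>
    (mul_eq_zero.mp (add_self_eq_zero.mp (hM i i))).resolve_left (hγ i)

/-- Invariance of the metric `γ = diag(1,…,1,λ₁,…,λ_p)` under the curvature algebra
of a symmetric space: `γ_{AA} C^A_{CD} + γ_{DD} C^D_{CA} = 0`, equivalently
`(C_A)ᵀ = -γ C_A γ⁻¹`, and in particular each `C_A` is traceless. -/
theorem gamma_invariant
    (n p : ℕ) (hn : 0 < n) (hp : 0 < p)
    (lam : Fin p → ℝ) (hlam : ∀ i, lam i ≠ 0)
    (E : Fin p → Matrix (Fin n) (Fin n) ℝ)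
    (hanti : ∀ i, (E i)ᵀ = -(E i))
    (D : Fin p → Matrix (Fin n) (Fin n) ℝ)
    (hD : ∀ i, D i = -(lam i) • E i)
    (F : Fin p → Fin p → Fin p → ℝ)
    (hF : ∀ i j l, lam i * F i j l + lam l * F l j i = 0)
    (Cc : (Fin n ⊕ Fin p) → (Fin n ⊕ Fin p) → (Fin n ⊕ Fin p) → ℝ)
    (hC1 : ∀ i a b, Cc (.inr i) (.inl a) (.inl b) = E i a b)
    (hC2 : ∀ a i b, Cc (.inl a) (.inr i) (.inl b) = D i a b)
    (hC3 : ∀ a b i, Cc (.inl a) (.inl b) (.inr i) = -(D i a b))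
    (hC4 : ∀ i k l, Cc (.inr i) (.inr k) (.inr l) = F i k l)
    (hC5 : ∀ a b c : Fin n, Cc (.inl a) (.inl b) (.inl c) = 0)
    (hC6 : ∀ (a : Fin n) (i k : Fin p), Cc (.inl a) (.inr i) (.inr k) = 0)
    (hC7 : ∀ (i : Fin p) (a : Fin n) (k : Fin p), Cc (.inr i) (.inl a) (.inr k) = 0)
    (hC8 : ∀ (i k : Fin p) (a : Fin n), Cc (.inr i) (.inr k) (.inl a) = 0)
    (γ : (Fin n ⊕ Fin p) → ℝ)
    (hγ : γ = Sum.elim (fun _ => (1:ℝ)) lam)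
    (γm : Matrix (Fin n ⊕ Fin p) (Fin n ⊕ Fin p) ℝ)
    (hγm : γm = Matrix.diagonal γ)
    (CM : (Fin n ⊕ Fin p) → Matrix (Fin n ⊕ Fin p) (Fin n ⊕ Fin p) ℝ)
    (hCM : ∀ A B C, CM A B C = Cc B A C) :
    (∀ A C D, γ A * Cc A C D + γ D * Cc D C A = 0) ∧
    (∀ A, (CM A)ᵀ = -(γm * CM A * γm⁻¹)) ∧
    (∀ A, (CM A).trace = 0) := by
  have hE : ∀ i a b, E i b a = -E i a b := fun i a b => congrFun (congrFun (hanti i) a) b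
  have hD' : ∀ i a b, D i a b = -(lam i * E i a b) := fun i a b => by simp [hD]
  have hinv : ∀ A C D, γ A * Cc A C D + γ D * Cc D C A = 0 := by
    subst hγ
    rintro (a | i) (c | j) (d | l)
    · simp [hC5]
    · simp [hC1, hC3, hD', hE l a c]
    · simp [hC2, hD', hE j a d]
    · simp [hC6, hC8]
    · simp [hC1, hC3, hD', hE i d c]
    · simp [hC7]
    · simp [hC6, hC8]
    · simpa [hC4] using hF i j l
  have hγ0 : ∀ A, γ A ≠ 0 := by
    subst hγ
    rintro (a | i)
    · simp
    · exact hlam i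
  have hskew : ∀ A B C, γ B * CM A B C + γ C * CM A C B = 0 := fun A B C => by
    rw [hCM, hCM]
    exact hinv B A C
  subst hγm
  exact ⟨hinv, fun A => transpose_eq_neg_diagonal_conj hγ0 (hskew A),
    fun A => trace_eq_zero_of_skew_diagonal hγ0 (hskew A)⟩
end

section
/- Let n, p be positive integers, λ₁, …, λ_p nonzero real numbers, E¹, …, E^p antisymmetric real n×n matrices, D_i := −λ_i Eⁱ, and Fʲ_{ik} real constants, satisfying: (i) [D_i, D_k] = Σ_j Fʲ_{ik} D_j; (ii) Σ_c (Eⁱ_{ac}(D_k)_{cb} − Eⁱ_{bc}(D_k)_{ca}) = Σ_j Fⁱ_{kj} Eʲ_{ab}; (iii) the first Bianchi identity R_{a[bcd]} = 0 for R_{abcd} := Σ_i λ_i Eⁱ_{ab} Eⁱ_{cd}. For y ∈ ℝⁿ let K(y) be the n×n matrix with entries K(y)^a{}_b = Σ_{c,d} R_{acbd}·y^c·y^d, and define vector fields on ℝⁿ by P_a(y) := f(K(y))·e_a, where f(K) := Σ_{k≥0} ((−4)^k·B_{2k}/(2k)!)·K^k is the power series of x·cot(x) evaluated at K (B_{2k}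 the Bernoulli numbers) and e_a is the a-th standard basis vector, and L_i(y) := −D_i·y. Then there exists ε > 0 such that on the ball ‖y‖ < ε the Lie brackets of these vector fields satisfy [P_a, P_b] = Σ_i Eⁱ_{ab}·L_i, [L_i, P_a] = Σ_b (D_i)_{ba}·P_b, and [L_i, L_k] = Σ_j Fʲ_{ik}·L_j, where the Lie bracket of vector fields U, V on ℝⁿ is [U,V](y) = (DV)(y)·U(y) − (DU)(y)·V(y). -/
open Matrix BigOperators

open Finset NormedSpace in
/-- The coefficients of the power series `z / (exp z - 1)` form the inverse of the coefficients of
`(exp z - 1) / z`. -/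
lemma sum_antidiagonal_bernoulli_div_factorial (n : ℕ) :
    ∑ k ∈ antidiagonal n, ((bernoulli k.1 : ℚ) : ℝ) / (k.1.factorial : ℝ) *
      ((k.2 + 1).factorial : ℝ)⁻¹ = if n = 0 then 1 else 0 := by
  have h : ∑ k ∈ antidiagonal n, ((bernoulli k.1 : ℚ) : ℝ) / (k.1.factorial : ℝ) *
      ((k.2 + 1).factorial : ℝ)⁻¹ = (n.factorial : ℝ)⁻¹ *
      ((∑ k ∈ antidiagonal n,
        ((k.1 + k.2).choose k.2 : ℚ) / (k.2 + 1) * bernoulli k.1 : ℚ) : ℝ) := by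
    push_cast
    rw [mul_sum]
    refine sum_congr rfl fun k hk => ?_
    rw [HasAntidiagonal.mem_antidiagonal] at hk
    subst hk
    have h1 := Nat.add_choose_mul_factorial_mul_factorial k.1 k.2
    have h2 : (((k.1 + k.2).choose k.2 : ℕ) : ℝ) =
        ((k.1 + k.2).factorial : ℝ) / (k.1.factorial * k.2.factorial) := by
      rw [← h1]
      push_cast
      field_simp
    rw [h2, Nat.factorial_succ]
    push_cast
    field_simp
  rw [h, bernoulli_spec']
  split_ifs with hn <;> simp [hn]

lemma two_pow_le_factorial_succ (n : ℕ) : 2 ^ n ≤ (n + 1).factorial := by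
  induction n with
  | zero => simp
  | succ n ih =>
    rw [Nat.factorial_succ, pow_succ]
    nlinarith

open Finset in
lemma abs_bernoulli_div_factorial_le_one (n : ℕ) :
    |((bernoulli n : ℚ) : ℝ) / (n.factorial : ℝ)| ≤ 1 := by
  induction n using Nat.strong_induction_on with
  | _ n ih =>
    rcases Nat.eq_zero_or_pos n with rfl | hn
    · simp
    have h := sum_antidiagonal_bernoulli_div_factorial n
    rw [if_neg hn.ne', Nat.sum_antidiagonal_eq_sum_range_succ_mk, sum_range_succ] at h
    simp only [Nat.sub_self, zero_add, Nat.factorial_one, Nat.cast_one, inv_one, mul_one] at h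
    rw [eq_neg_of_add_eq_zero_right h, abs_neg]
    have hgeom : ∑ i ∈ range n, (1 / 2 : ℝ) ^ (n - i) ≤ 1 := by
      have := sum_range_reflect (fun i => (1 / 2 : ℝ) ^ (i + 1)) n
      rw [sum_congr rfl (g := fun i => (1 / 2 : ℝ) ^ (n - 1 - i + 1))]
      · rw [this]
        simp_rw [pow_succ]
        rw [← sum_mul, geom_sum_eq (by norm_num)]
        have : (0 : ℝ) ≤ (1 / 2) ^ n := by positivity
        rw [show (1 / 2 : ℝ) - 1 = -(1 / 2) by norm_num]
        linarith
      · intro i hi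
        rw [mem_range] at hi
        congr 1
        omega
    refine (abs_sum_le_sum_abs _ _).trans (le_trans (sum_le_sum fun i hi => ?_) hgeom)
    rw [mem_range] at hi
    rw [abs_mul]
    refine (mul_le_of_le_one_left (abs_nonneg _) (ih i hi)).trans ?_
    rw [abs_of_nonneg (by positivity), one_div, inv_pow]
    exact inv_anti₀ (by positivity) (by exact_mod_cast two_pow_le_factorial_succ _)

section ScalarSeries

variable {A : Type*} [NormedRing A] [NormedAlgebra ℝ A] {c : ℕ → ℝ}

lemma summable_norm_smul_pow (hc : ∀ k, |c k| ≤ 1) {x : A} (hx : ‖x‖ < 1) :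
    Summable fun k => ‖c k • x ^ k‖ := by
  refine Summable.of_nonneg_of_le (fun _ => norm_nonneg _) (fun k => ?_)
    (summable_norm_geometric_of_norm_lt_one hx)
  rw [norm_smul]
  exact mul_le_of_le_one_left (norm_nonneg _) (hc k)

variable [CompleteSpace A]

lemma differentiableAt_tsum_smul_pow (hc : ∀ k, |c k| ≤ 1) {x : A} (hx : ‖x‖ < 1) :
    DifferentiableAt ℝ (fun x : A => ∑' k, c k • x ^ k) x := by
  have hr : (1 : ENNReal) ≤ (FormalMultilinearSeries.ofScalars A c).radius := by
    refine FormalMultilinearSeries.le_radius_of_eventually_le (r := 1) _ 1 ?_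
    filter_upwards [Filter.eventually_gt_atTop 0] with n hn
    simpa using (FormalMultilinearSeries.ofScalars_norm_le A c n hn).trans (hc n)
  have h := ((FormalMultilinearSeries.ofScalars A c).hasFPowerSeriesOnBall
    (lt_of_lt_of_le one_pos hr)).analyticAt_of_mem (y := x) (by
      refine Metric.eball_subset_eball hr ?_
      rw [Metric.mem_eball, edist_zero_right]
      simpa [enorm_eq_nnnorm, ← NNReal.coe_lt_coe] using hx)
  have h2 := h.differentiableAt
  rwa [show (FormalMultilinearSeries.ofScalars A c).sum = fun x : A => ∑' k, c k • x ^ k from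
    FormalMultilinearSeries.ofScalarsSum_eq_tsum c] at h2

lemma tsum_smul_pow_units_conj (hc : ∀ k, |c k| ≤ 1) {x : A} (hx : ‖x‖ < 1) (u : Aˣ) :
    ∑' k, c k • (u * x * ↑u⁻¹ : A) ^ k = u * (∑' k, c k • x ^ k) * ↑u⁻¹ := by
  rw [← (summable_norm_smul_pow hc hx).of_norm.tsum_mul_left,
    ← ((summable_norm_smul_pow hc hx).of_norm.mul_left _).tsum_mul_right]
  refine tsum_congr fun k => ?_
  rw [Units.conj_pow]
  simp

lemma HasFDerivAt.apply_commutator_of_units_conj {f : A → A} {f' : A →L[ℝ] A} {x : A}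
    (hf : HasFDerivAt f f' x) (hconj : ∀ u : Aˣ, f (u * x * ↑u⁻¹) = u * f x * ↑u⁻¹) (a : A) :
    f' (a * x - x * a) = a * f x - f x * a := by
  have hd : ∀ z : A, HasDerivAt
      (fun s : ℝ => NormedSpace.exp (s • a) * z * NormedSpace.exp (s • (-a))) (a * z - z * a) 0 := by
    intro z
    have h1 := hasDerivAt_exp_smul_const (𝕂 := ℝ) a 0
    have h2 := hasDerivAt_exp_smul_const (𝕂 := ℝ) (-a) 0
    have := (h1.mul_const z).fun_mul h2
    simpa [sub_eq_add_neg] using this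
  have hu : ∀ s : ℝ, NormedSpace.exp (s • a) * NormedSpace.exp (s • (-a)) = 1 ∧
      NormedSpace.exp (s • (-a)) * NormedSpace.exp (s • a) = 1 := by
    intro s
    let _ := NormedAlgebra.restrictScalars ℚ ℝ A
    rw [← NormedSpace.exp_add_of_commute, ← NormedSpace.exp_add_of_commute]
    · simp
    · simp [smul_neg]
    · simp [smul_neg]
  have h3 : (fun s : ℝ => f (NormedSpace.exp (s • a) * x * NormedSpace.exp (s • (-a)))) =
      fun s : ℝ => NormedSpace.exp (s • a) * f x * NormedSpace.exp (s • (-a)) := by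
    funext s
    exact hconj ⟨NormedSpace.exp (s • a), NormedSpace.exp (s • (-a)), (hu s).1, (hu s).2⟩
  have h4 : HasDerivAt
      (fun s : ℝ => f (NormedSpace.exp (s • a) * x * NormedSpace.exp (s • (-a))))
      (f' (a * x - x * a)) 0 := by
    refine HasFDerivAt.comp_hasDerivAt (l := f) (0 : ℝ) ?_ (hd x)
    simpa using hf
  rw [h3] at h4
  exact h4.unique (hd (f x))

end ScalarSeries

section ExpDerivative

variable {A : Type*} [NormedRing A] [NormedAlgebra ℝ A]

/-- The bounded operator `v ↦ x * v - v * x` on a normed algebra. -/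
noncomputable def commutatorCLM (x : A) : A →L[ℝ] A :=
  ContinuousLinearMap.mul ℝ A x - (ContinuousLinearMap.mul ℝ A).flip x

lemma commutatorCLM_apply (x v : A) : commutatorCLM x v = x * v - v * x := by
  simp [commutatorCLM]

lemma commutatorCLM_zero : commutatorCLM (0 : A) = 0 := by
  ext v
  simp [commutatorCLM_apply]

lemma continuous_commutatorCLM : Continuous (commutatorCLM : A → A →L[ℝ] A) := by
  unfold commutatorCLM
  fun_prop

open Finset in
lemma sum_pow_mul_mul_pow (x v : A) (n : ℕ) :
    ∑ i ∈ range (n + 1), x ^ (n - i) * v * x ^ i =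
      ∑ b ∈ range (n + 1),
        ((n + 1).choose (b + 1) : ℝ) • ((commutatorCLM x ^ b) v * x ^ (n - b)) := by
  induction n with
  | zero => simp
  | succ n ih =>
    have h1 : ∑ i ∈ range (n + 2), x ^ (n + 1 - i) * v * x ^ i =
        x * (∑ i ∈ range (n + 1), x ^ (n - i) * v * x ^ i) + v * x ^ (n + 1) := by
      rw [sum_range_succ, mul_sum]
      congr 1
      · refine sum_congr rfl fun i hi => ?_
        rw [mem_range] at hi
        rw [show n + 1 - i = (n - i) + 1 by omega, pow_succ']
        simp only [mul_assoc]
      · simp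
    have h2 : x * (∑ b ∈ range (n + 1),
        ((n + 1).choose (b + 1) : ℝ) • ((commutatorCLM x ^ b) v * x ^ (n - b))) =
        (∑ b ∈ range (n + 1),
          ((n + 1).choose (b + 1) : ℝ) • ((commutatorCLM x ^ (b + 1)) v * x ^ (n - b))) +
        ∑ b ∈ range (n + 1),
          ((n + 1).choose (b + 1) : ℝ) • ((commutatorCLM x ^ b) v * x ^ (n + 1 - b)) := by
      rw [mul_sum, ← sum_add_distrib]
      refine sum_congr rfl fun b hb => ?_
      rw [mem_range] at hb
      rw [← smul_add, mul_smul_comm, pow_succ' (commutatorCLM x), mul_apply_eq_comp,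
        commutatorCLM_apply, show n + 1 - b = (n - b) + 1 by omega, pow_succ' x]
      congr 1
      noncomm_ring
    have h3 : v * x ^ (n + 1) + (∑ b ∈ range (n + 1),
          ((n + 1).choose (b + 1) : ℝ) • ((commutatorCLM x ^ (b + 1)) v * x ^ (n - b))) =
        ∑ b ∈ range (n + 2),
          ((n + 1).choose b : ℝ) • ((commutatorCLM x ^ b) v * x ^ (n + 1 - b)) := by
      rw [sum_range_succ' _ (n + 1), add_comm]
      simp
    rw [h1, ih, h2]
    rw [add_comm, ← add_assoc, h3]
    have h4 : ∑ b ∈ range (n + 1),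
          ((n + 1).choose (b + 1) : ℝ) • ((commutatorCLM x ^ b) v * x ^ (n + 1 - b)) =
        ∑ b ∈ range (n + 2),
          ((n + 1).choose (b + 1) : ℝ) • ((commutatorCLM x ^ b) v * x ^ (n + 1 - b)) := by
      rw [sum_range_succ _ (n + 1)]
      simp
    rw [h4, ← sum_add_distrib]
    refine sum_congr rfl fun b _ => ?_
    rw [← add_smul, Nat.choose_succ_succ (n + 1) b]
    push_cast
    rfl

lemma summable_norm_expSubOneDiv (z : A) :
    Summable fun k : ℕ => ‖((k + 1).factorial : ℝ)⁻¹ • z ^ k‖ := by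
  refine Summable.of_nonneg_of_le (fun _ => norm_nonneg _) (fun k => ?_)
    (NormedSpace.norm_expSeries_summable' (𝕂 := ℝ) z)
  rw [norm_smul, norm_smul]
  gcongr ?_ * _
  rw [norm_inv, norm_inv, RCLike.norm_natCast, RCLike.norm_natCast]
  exact inv_anti₀ (by positivity) (by exact_mod_cast Nat.factorial_le (Nat.le_succ k))

variable [CompleteSpace A]

open Finset in
lemma hasSum_fderiv_exp (x v : A) :
    HasSum (fun n => ((n + 1).factorial : ℝ)⁻¹ • ∑ i ∈ range (n + 1), x ^ (n - i) * v * x ^ i)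
      (fderiv ℝ NormedSpace.exp x v) := by
  set r : ℝ := ‖x‖ + 1 with hr
  have hr1 : (1 : ℝ) ≤ r := by simp [hr]
  set f' : ℕ → A → A →L[ℝ] A := fun n y => (n.factorial : ℝ)⁻¹ •
    ∑ i ∈ range n, (ContinuousLinearMap.mul ℝ A (y ^ (n.pred - i))).comp
      ((ContinuousLinearMap.mul ℝ A).flip (y ^ i)) with hf'
  have hpow : ∀ y : A, ‖y‖ < r → ∀ n, ‖y ^ n‖ ≤ (‖(1 : A)‖ + 1) * r ^ n := by
    intro y hy n
    rcases Nat.eq_zero_or_pos n with rfl | hn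
    · simp
    · refine (norm_pow_le' y hn).trans ((pow_le_pow_left₀ (norm_nonneg _) hy.le n).trans ?_)
      exact le_mul_of_one_le_left (by positivity) (by linarith [norm_nonneg (1 : A)])
  set C : ℝ := ‖(1 : A)‖ + 1 with hC
  have hC0 : 0 ≤ C := by positivity
  have hbound : ∀ (n : ℕ) (y : A), y ∈ Metric.ball (0 : A) r →
      ‖f' n y‖ ≤ C ^ 2 * ((2 * r) ^ n / n.factorial) := by
    intro n y hy
    rw [mem_ball_zero_iff] at hy
    simp only [hf', norm_smul]
    have h1 : ‖∑ i ∈ range n, (ContinuousLinearMap.mul ℝ A (y ^ (n.pred - i))).comp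
      ((ContinuousLinearMap.mul ℝ A).flip (y ^ i))‖ ≤ n * (C ^ 2 * r ^ n) := by
      refine (norm_sum_le _ _).trans ((sum_le_card_nsmul _ _ (C ^ 2 * r ^ n) fun i hi => ?_).trans
        (by simp))
      rw [mem_range] at hi
      refine (ContinuousLinearMap.opNorm_comp_le _ _).trans ?_
      have h2 : ‖(ContinuousLinearMap.mul ℝ A).flip (y ^ i)‖ ≤ ‖y ^ i‖ :=
        ContinuousLinearMap.opNorm_le_bound _ (norm_nonneg _) fun z => by
          simpa [mul_comm] using norm_mul_le z (y ^ i)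
      calc _ ≤ ‖y ^ (n.pred - i)‖ * ‖y ^ i‖ :=
            mul_le_mul (ContinuousLinearMap.opNorm_mul_apply_le ℝ A _) h2 (norm_nonneg _)
              (norm_nonneg _)
        _ ≤ (C * r ^ (n.pred - i)) * (C * r ^ i) :=
            mul_le_mul (hpow y hy _) (hpow y hy _) (norm_nonneg _) (by positivity)
        _ = C ^ 2 * r ^ (n - 1) := by
            rw [show n - 1 = (n.pred - i) + i by simp only [Nat.pred_eq_sub_one]; omega, pow_add]
            ring
        _ ≤ C ^ 2 * r ^ n := by
            gcongr
            · omega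
    have h3 : (n : ℝ) ≤ 2 ^ n := by exact_mod_cast Nat.lt_two_pow_self.le
    rw [norm_inv, RCLike.norm_natCast]
    calc _ ≤ (n.factorial : ℝ)⁻¹ * (2 ^ n * (C ^ 2 * r ^ n)) := by
          gcongr
          exact h1.trans (by gcongr)
      _ = _ := by rw [mul_pow]; ring
  have hsum : Summable fun n : ℕ => C ^ 2 * ((2 * r) ^ n / n.factorial) :=
    (Real.summable_pow_div_factorial _).mul_left _
  have hderiv : ∀ (n : ℕ) (y : A), y ∈ Metric.ball (0 : A) r →
      HasFDerivAt (fun y : A => (n.factorial : ℝ)⁻¹ • y ^ n) (f' n y) y := by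
    intro n y _
    refine ((hasFDerivAt_pow' (𝕜 := ℝ) n (x := y)).const_smul (n.factorial : ℝ)⁻¹).congr_fderiv ?_
    ext z
    simp [hf', mul_assoc]
  have hx : x ∈ Metric.ball (0 : A) r := by simp [hr]
  have hmain := hasFDerivAt_tsum_of_isPreconnected hsum Metric.isOpen_ball
    (convex_ball (0 : A) r).isPreconnected hderiv hbound hx
    (NormedSpace.expSeries_summable' (𝕂 := ℝ) x) hx
  rw [← NormedSpace.exp_eq_tsum ℝ] at hmain
  rw [hmain.fderiv]
  have hs : HasSum (fun n => f' n x) (∑' n, f' n x) :=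
    (Summable.of_norm_bounded hsum fun n => hbound n x hx).hasSum
  have hs2 := (ContinuousLinearMap.apply ℝ A v).hasSum hs
  have hs3 := (hasSum_nat_add_iff' 1).mpr hs2
  rw [range_one, sum_singleton] at hs3
  have hs4 : (ContinuousLinearMap.apply ℝ A v) (f' 0 x) = 0 := by simp [hf']
  rw [hs4, sub_zero] at hs3
  have hterm : (fun n => ((n + 1).factorial : ℝ)⁻¹ •
      ∑ i ∈ range (n + 1), x ^ (n - i) * v * x ^ i) =
      fun n => ContinuousLinearMap.apply ℝ A v (f' (n + 1) x) := by
    funext n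
    simp [hf', mul_assoc]
  rw [hterm]
  exact hs3

/-- The power series of `(exp z - 1) / z`. -/
noncomputable def expSubOneDiv (z : A) : A := ∑' k : ℕ, ((k + 1).factorial : ℝ)⁻¹ • z ^ k

/-- The power series of `z / (exp z - 1)`. -/
noncomputable def bernoulliSum (z : A) : A :=
  ∑' k : ℕ, (((bernoulli k : ℚ) : ℝ) / (k.factorial : ℝ)) • z ^ k

open Finset in
lemma bernoulliSum_mul_expSubOneDiv {z : A} (hz : ‖z‖ < 1) :
    bernoulliSum z * expSubOneDiv z = 1 := by
  rw [bernoulliSum, expSubOneDiv, tsum_mul_tsum_eq_tsum_sum_antidiagonal_of_summable_norm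
    (summable_norm_smul_pow abs_bernoulli_div_factorial_le_one hz) (summable_norm_expSubOneDiv z)]
  rw [tsum_eq_single 0]
  · simp
  · intro n hn
    have h := sum_antidiagonal_bernoulli_div_factorial n
    rw [if_neg hn] at h
    rw [← zero_smul ℝ (z ^ n), ← h, sum_smul]
    refine sum_congr rfl fun k hk => ?_
    rw [HasAntidiagonal.mem_antidiagonal] at hk
    rw [smul_mul_smul_comm, ← pow_add, hk]

open Finset in
lemma expSubOneDiv_mul_bernoulliSum {z : A} (hz : ‖z‖ < 1) :
    expSubOneDiv z * bernoulliSum z = 1 := by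
  rw [bernoulliSum, expSubOneDiv, tsum_mul_tsum_eq_tsum_sum_antidiagonal_of_summable_norm
    (summable_norm_expSubOneDiv z) (summable_norm_smul_pow abs_bernoulli_div_factorial_le_one hz)]
  rw [tsum_eq_single 0]
  · simp
  · intro n hn
    have h := sum_antidiagonal_bernoulli_div_factorial n
    rw [if_neg hn, ← Finset.Nat.sum_antidiagonal_swap] at h
    rw [← zero_smul ℝ (z ^ n), ← h, sum_smul]
    refine sum_congr rfl fun k hk => ?_
    rw [HasAntidiagonal.mem_antidiagonal] at hk
    rw [smul_mul_smul_comm, ← pow_add, hk, mul_comm]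
    rfl

lemma tsum_even_smul_pow {c : ℕ → ℝ} (hc : ∀ k : ℕ, |c k| ≤ 1)
    (hodd : ∀ k : ℕ, k ≠ 0 → c (2 * k + 1) = 0) {z : A} (hz : ‖z‖ < 1) :
    ∑' k : ℕ, c (2 * k) • z ^ (2 * k) = ∑' k : ℕ, c k • z ^ k - c 1 • z := by
  have hs : Summable fun k => c k • z ^ k := (summable_norm_smul_pow hc hz).of_norm
  have h1 : Summable fun k => c (2 * k) • z ^ (2 * k) :=
    hs.comp_injective (i := fun k => 2 * k) (fun a b h => by simpa using h)
  have h2 : Summable fun k => c (2 * k + 1) • z ^ (2 * k + 1) :=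
    hs.comp_injective (i := fun k => 2 * k + 1) (fun a b h => by simpa using h)
  have h3 : ∑' k, c (2 * k + 1) • z ^ (2 * k + 1) = c 1 • z := by
    rw [tsum_eq_single 0]
    · rw [mul_zero, zero_add, pow_one]
    · intro k hk
      rw [hodd k hk, zero_smul]
  rw [← h3]
  refine eq_sub_of_add_eq ?_
  exact tsum_even_add_odd (f := fun k => c k • z ^ k) h1 h2

/-- The even part of `z / (exp z - 1)` differs from it by the linear term. -/
lemma tsum_even_bernoulli {z : A} (hz : ‖z‖ < 1) :
    ∑' k : ℕ, (((bernoulli (2 * k) : ℚ) : ℝ) / ((2 * k).factorial : ℝ)) • z ^ (2 * k) =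
      bernoulliSum z + (1 / 2 : ℝ) • z := by
  have h := tsum_even_smul_pow (c := fun k => ((bernoulli k : ℚ) : ℝ) / (k.factorial : ℝ))
    abs_bernoulli_div_factorial_le_one (fun k hk => by
      rw [bernoulli_eq_zero_of_odd ⟨k, rfl⟩ (by omega)]
      simp) hz
  rw [h, bernoulliSum, bernoulli_one]
  norm_num [sub_eq_add_neg, ← neg_smul]

open Finset in
/-- Differential of the exponential of a noncommutative Banach algebra. -/
lemma fderiv_exp_apply (x v : A) :
    fderiv ℝ NormedSpace.exp x v = expSubOneDiv (commutatorCLM x) v * NormedSpace.exp x := by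
  have hs := summable_norm_expSubOneDiv (commutatorCLM x)
  have h1 : Summable fun k : ℕ => ‖((k + 1).factorial : ℝ)⁻¹ • (commutatorCLM x ^ k) v‖ := by
    refine Summable.of_nonneg_of_le (fun _ => norm_nonneg _) (fun k => ?_) (hs.mul_right ‖v‖)
    exact (((k + 1).factorial : ℝ)⁻¹ • commutatorCLM x ^ k).le_opNorm v
  have h2 : expSubOneDiv (commutatorCLM x) v =
      ∑' k : ℕ, ((k + 1).factorial : ℝ)⁻¹ • (commutatorCLM x ^ k) v :=
    (ContinuousLinearMap.apply ℝ A v).map_tsum hs.of_norm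
  rw [h2, NormedSpace.exp_eq_tsum ℝ, tsum_mul_tsum_eq_tsum_sum_antidiagonal_of_summable_norm h1
    (NormedSpace.norm_expSeries_summable' (𝕂 := ℝ) x), ← NormedSpace.exp_eq_tsum ℝ,
    ← (hasSum_fderiv_exp x v).tsum_eq]
  refine tsum_congr fun n => ?_
  rw [sum_pow_mul_mul_pow, Nat.sum_antidiagonal_eq_sum_range_succ_mk, smul_sum]
  refine sum_congr rfl fun b hb => ?_
  rw [mem_range] at hb
  rw [smul_mul_smul_comm, smul_smul]
  congr 1
  rw [Nat.cast_choose ℝ (show b + 1 ≤ n + 1 by omega), show n + 1 - (b + 1) = n - b by omega]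
  have := Nat.factorial_ne_zero (n + 1)
  field_simp

lemma differentiable_exp : Differentiable ℝ (NormedSpace.exp : A → A) :=
  fun x => (NormedSpace.exp_analytic (𝕂 := ℝ) x).differentiableAt

lemma fderiv_exp_commutatorCLM (a x : A) :
    fderiv ℝ NormedSpace.exp x (commutatorCLM a x) = commutatorCLM a (NormedSpace.exp x) := by
  rw [commutatorCLM_apply, commutatorCLM_apply]
  refine (differentiable_exp x).hasFDerivAt.apply_commutator_of_units_conj (fun u => ?_) a
  let _ := NormedAlgebra.restrictScalars ℚ ℝ A
  exact NormedSpace.exp_units_conj u x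

lemma eq_zero_of_fderiv_exp_eq_zero {x v : A} (hx : ‖commutatorCLM x‖ < 1)
    (hv : fderiv ℝ NormedSpace.exp x v = 0) : v = 0 := by
  let _ := NormedAlgebra.restrictScalars ℚ ℝ A
  rw [fderiv_exp_apply, (NormedSpace.isUnit_exp x).mul_left_eq_zero] at hv
  have h := congrArg (fun T : A →L[ℝ] A => T v) (bernoulliSum_mul_expSubOneDiv hx)
  simpa [hv] using h.symm

/-- The power series of `z coth z` describes the pullback along the exponential of the infinitesimal
symmetric translation `m ↦ v * m + m * v`. -/
lemma fderiv_exp_tsum_even_bernoulli {x : A} (hx : ‖commutatorCLM x‖ < 1) (v : A) :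
    fderiv ℝ NormedSpace.exp x
      ((2 : ℝ) • (∑' k : ℕ, (((bernoulli (2 * k) : ℚ) : ℝ) / ((2 * k).factorial : ℝ)) •
        commutatorCLM x ^ (2 * k)) v) = v * NormedSpace.exp x + NormedSpace.exp x * v := by
  rw [tsum_even_bernoulli hx]
  have h1 : fderiv ℝ NormedSpace.exp x (bernoulliSum (commutatorCLM x) v) =
      v * NormedSpace.exp x := by
    rw [fderiv_exp_apply, ← mul_apply_eq_comp, expSubOneDiv_mul_bernoulliSum hx]
    rfl
  have h2 : fderiv ℝ NormedSpace.exp x (commutatorCLM x v) =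
      NormedSpace.exp x * v - v * NormedSpace.exp x := by
    have h3 := fderiv_exp_commutatorCLM v x
    rw [commutatorCLM_apply] at h3 ⊢
    rw [← neg_sub, map_neg, h3, commutatorCLM_apply, neg_sub]
  rw [map_smul, _root_.add_apply, _root_.smul_apply, map_add, map_smul,
    h1, h2, smul_add, smul_smul]
  norm_num
  rw [two_smul]
  abel

end ExpDerivative

section CotSeries

variable {A : Type*} [NormedRing A] [NormedAlgebra ℝ A]

/-- The power series in `x` of `√x cot √x`. -/
noncomputable def cotSeries (x : A) : A :=
  ∑' k : ℕ, ((-4 : ℝ) ^ k * ((bernoulli (2 * k) : ℚ) : ℝ) / (Nat.factorial (2 * k))) • x ^ k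

lemma cotSeries_eq (x : A) : cotSeries x =
    ∑' k : ℕ, (((bernoulli (2 * k) : ℚ) : ℝ) / ((2 * k).factorial : ℝ)) • ((-4 : ℝ) • x) ^ k := by
  refine tsum_congr fun k => ?_
  rw [smul_pow, smul_smul]
  congr 1
  ring

variable [CompleteSpace A]

lemma differentiableAt_cotSeries {x : A} (hx : ‖(-4 : ℝ) • x‖ < 1) :
    DifferentiableAt ℝ cotSeries x := by
  have h := differentiableAt_tsum_smul_pow
    (fun k => abs_bernoulli_div_factorial_le_one (2 * k)) hx
  rw [show (cotSeries : A → A) = _ from funext cotSeries_eq]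
  exact DifferentiableAt.comp (g := fun x : A =>
    ∑' k : ℕ, (((bernoulli (2 * k) : ℚ) : ℝ) / ((2 * k).factorial : ℝ)) • x ^ k) x h
    (differentiableAt_id.const_smul (-4 : ℝ))

lemma cotSeries_units_conj {x : A} (hx : ‖(-4 : ℝ) • x‖ < 1) (u : Aˣ) :
    cotSeries (u * x * ↑u⁻¹) = u * cotSeries x * ↑u⁻¹ := by
  rw [cotSeries_eq, cotSeries_eq, ← tsum_smul_pow_units_conj
    (fun k => abs_bernoulli_div_factorial_le_one (2 * k)) hx]
  simp

lemma fderiv_cotSeries_commutator {x : A} (hx : ‖(-4 : ℝ) • x‖ < 1) (a : A) :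
    fderiv ℝ cotSeries x (a * x - x * a) = a * cotSeries x - cotSeries x * a :=
  (differentiableAt_cotSeries hx).hasFDerivAt.apply_commutator_of_units_conj
    (cotSeries_units_conj hx) a

variable {V : Type*} [NormedAddCommGroup V] [NormedSpace ℝ V]

lemma cotSeries_apply_intertwine [CompleteSpace V] {ρ : V →L[ℝ] A} {κ : V →L[ℝ] V} {z : A}
    (hρ : ∀ x, ρ (κ x) = -commutatorCLM z (commutatorCLM z (ρ x)))
    (hκ : ‖(-4 : ℝ) • κ‖ < 1) (hz : ‖commutatorCLM ((2 : ℝ) • z)‖ < 1) (x : V) :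
    ρ (cotSeries κ x) = (∑' k : ℕ, (((bernoulli (2 * k) : ℚ) : ℝ) / ((2 * k).factorial : ℝ)) •
        commutatorCLM ((2 : ℝ) • z) ^ (2 * k)) (ρ x) := by
  have hs1 : Summable fun k : ℕ =>
      (((bernoulli (2 * k) : ℚ) : ℝ) / ((2 * k).factorial : ℝ)) • ((-4 : ℝ) • κ) ^ k :=
    (summable_norm_smul_pow (fun k => abs_bernoulli_div_factorial_le_one (2 * k)) hκ).of_norm
  have hs2 : Summable fun k : ℕ => (((bernoulli (2 * k) : ℚ) : ℝ) / ((2 * k).factorial : ℝ)) •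
        commutatorCLM ((2 : ℝ) • z) ^ (2 * k) :=
    (summable_norm_smul_pow abs_bernoulli_div_factorial_le_one hz).of_norm.comp_injective
      (i := fun k => 2 * k) (fun a b h => by simpa using h)
  have h1 := (ρ.comp (ContinuousLinearMap.apply ℝ V x)).map_tsum hs1
  have h2 := (ContinuousLinearMap.apply ℝ A (ρ x)).map_tsum hs2
  rw [cotSeries_eq]
  refine h1.trans (Eq.trans (tsum_congr fun k => ?_) h2.symm)
  have h3 : ∀ (k : ℕ) (x : V), ρ ((((-4 : ℝ) • κ) ^ k) x) =
      (commutatorCLM ((2 : ℝ) • z) ^ (2 * k)) (ρ x) := by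
    intro k
    induction k with
    | zero => simp
    | succ k ih =>
      intro x
      rw [pow_succ, mul_apply_eq_comp, ih, mul_add, pow_add, mul_apply_eq_comp,
        mul_one, pow_two, mul_apply_eq_comp, _root_.smul_apply, map_smul, hρ]
      congr 1
      simp only [commutatorCLM_apply, smul_mul_assoc, mul_smul_comm, ← smul_sub, smul_smul,
        smul_neg, ← neg_smul]
      norm_num
  have h4 := congrArg (fun w => (((bernoulli (2 * k) : ℚ) : ℝ) / ((2 * k).factorial : ℝ)) • w)
    (h3 k x)
  rw [← map_smul] at h4
  exact h4

/-- The differential of `y ↦ exp (2 ρ y)` sends the vector field `y ↦ cotSeries (κ y) a`, when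
`κ y = -(ad (ρ y)) ^ 2` along `ρ`, to an infinitesimal symmetric translation. -/
lemma fderiv_exp_cotSeries_apply [CompleteSpace V] {ρ : V →L[ℝ] A} {κ : V →L[ℝ] V} {y : V}
    (hρ : ∀ x, ρ (κ x) = -commutatorCLM (ρ y) (commutatorCLM (ρ y) (ρ x)))
    (hκ : ‖(-4 : ℝ) • κ‖ < 1) (hy : ‖commutatorCLM ((2 : ℝ) • ρ y)‖ < 1) (a : V) :
    fderiv ℝ (fun y => NormedSpace.exp ((2 : ℝ) • ρ y)) y (cotSeries κ a) =
      ρ a * NormedSpace.exp ((2 : ℝ) • ρ y) + NormedSpace.exp ((2 : ℝ) • ρ y) * ρ a := by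
  have h : HasFDerivAt (fun y => NormedSpace.exp ((2 : ℝ) • ρ y))
      ((fderiv ℝ NormedSpace.exp ((2 : ℝ) • ρ y)).comp ((2 : ℝ) • ρ)) y :=
    (differentiable_exp _).hasFDerivAt.comp y (((2 : ℝ) • ρ).hasFDerivAt)
  rw [h.fderiv, ← fderiv_exp_tsum_even_bernoulli hy, ← cotSeries_apply_intertwine hρ hκ hy]
  rfl

lemma apply_lieBracket_cotSeries [CompleteSpace V] {ρ : V →L[ℝ] A} {κ : V → V →L[ℝ] V}
    (hdiff : Differentiable ℝ κ)
    (hρ : ∀ y x, ρ (κ y x) = -commutatorCLM (ρ y) (commutatorCLM (ρ y) (ρ x))) {y : V}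
    (hκ : ‖(-4 : ℝ) • κ y‖ < 1) (hy : ‖commutatorCLM ((2 : ℝ) • ρ y)‖ < 1) {a b v : V}
    (hv : ρ v = commutatorCLM (commutatorCLM (ρ b) (ρ a)) (ρ y)) :
    ρ (VectorField.lieBracket ℝ (fun y => cotSeries (κ y) a) (fun y => cotSeries (κ y) b) y) =
      ρ v := by
  set M : V → A := fun y => NormedSpace.exp ((2 : ℝ) • ρ y) with hM
  have hMd : ∀ y, HasFDerivAt M
      ((fderiv ℝ NormedSpace.exp ((2 : ℝ) • ρ y)).comp ((2 : ℝ) • ρ)) y := fun y =>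
    (differentiable_exp _).hasFDerivAt.comp y (((2 : ℝ) • ρ).hasFDerivAt)
  have hopen : ∀ᶠ y' in nhds y, ‖(-4 : ℝ) • κ y'‖ < 1 ∧ ‖commutatorCLM ((2 : ℝ) • ρ y')‖ < 1 := by
    refine Filter.Eventually.and ?_ ?_
    · exact (hdiff.continuous.const_smul (-4 : ℝ)).norm.continuousAt.eventually_lt
        continuousAt_const hκ
    · exact (continuous_commutatorCLM.comp
        (ρ.continuous.const_smul (2 : ℝ))).norm.continuousAt.eventually_lt
        continuousAt_const hy
  have hP : ∀ a : V, DifferentiableAt ℝ (fun y => cotSeries (κ y) a) y := fun a =>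
    (DifferentiableAt.comp (g := cotSeries) y (differentiableAt_cotSeries hκ) (hdiff y)).clm_apply
      (differentiableAt_const a)
  have hC : ContDiffAt ℝ 2 M y := by
    have h1 : ContDiffAt ℝ 2 (NormedSpace.exp : A → A) ((2 : ℝ) • ρ y) :=
      (NormedSpace.exp_analytic (𝕂 := ℝ) _).contDiffAt
    exact h1.comp y ((2 : ℝ) • ρ).contDiff.contDiffAt
  have hcross : ∀ a b : V, fderiv ℝ (fun y => fderiv ℝ M y (cotSeries (κ y) b)) y
      (cotSeries (κ y) a) = ρ b * (ρ a * M y + M y * ρ a) + (ρ a * M y + M y * ρ a) * ρ b := by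
    intro a b
    have he : (fun y => fderiv ℝ M y (cotSeries (κ y) b)) =ᶠ[nhds y]
        fun y => ρ b * M y + M y * ρ b := by
      filter_upwards [hopen] with y' hy'
      exact fderiv_exp_cotSeries_apply (hρ y') hy'.1 hy'.2 b
    have hd := ((hMd y).differentiableAt.hasFDerivAt.const_mul (ρ b)).fun_add
      ((hMd y).differentiableAt.hasFDerivAt.mul_const' (ρ b))
    rw [he.fderiv_eq, hd.fderiv, ← fderiv_exp_cotSeries_apply (hρ y) hκ hy a]
    simp [hM]
  have h1 : fderiv ℝ M y (VectorField.lieBracket ℝ (fun y => cotSeries (κ y) a)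
      (fun y => cotSeries (κ y) b) y) = fderiv ℝ M y v := by
    rw [VectorField.fderiv_apply_lieBracket hC (by simp) (hP b) (hP a), hcross, hcross,
      (hMd y).fderiv, ContinuousLinearMap.comp_apply, _root_.smul_apply, hv,
      ← map_smul (commutatorCLM _), fderiv_exp_commutatorCLM, commutatorCLM_apply, commutatorCLM_apply]
    simp only [hM]
    noncomm_ring
  rw [(hMd y).fderiv, ← sub_eq_zero, ← map_sub] at h1
  have h2 := eq_zero_of_fderiv_exp_eq_zero hy h1
  rw [map_sub, sub_eq_zero] at h2
  exact smul_right_injective A (two_ne_zero (α := ℝ)) h2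

end CotSeries

section LieTripleSystem

variable {V W : Type*} [NormedAddCommGroup V] [NormedSpace ℝ V] [FiniteDimensional ℝ V]
  [NormedAddCommGroup W] [NormedSpace ℝ W] [FiniteDimensional ℝ W]

/-- The derivations of a trilinear operation. -/
def tripleDerivations (T : V →L[ℝ] V →L[ℝ] V →L[ℝ] V) : Submodule ℝ (V →L[ℝ] V) where
  carrier := {S | ∀ x w z, S (T x w z) = T (S x) w z + T x (S w) z + T x w (S z)}
  add_mem' := by
    intro S S' hS hS' x w z
    simp only [_root_.add_apply, map_add, hS x w z, hS' x w z]
    abel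
  zero_mem' := by
    intro x w z
    simp
  smul_mem' := by
    intro c S hS x w z
    simp only [_root_.smul_apply, map_smul, hS x w z, smul_add]

/-- The standard embedding of a Lie triple system `V` into the operators on the sum of `V` and a
space `W` acting on `V` through `ι`, where `δ x` plays the role of the inner derivations. -/
noncomputable def standardEmbedding (ι : W →L[ℝ] V →L[ℝ] V) (δ : V →L[ℝ] V →L[ℝ] W) :
    V →L[ℝ] (V × W) →L[ℝ] (V × W) :=
  LinearMap.toContinuousBilinearMap
    (LinearMap.mk₂ ℝ (fun (y : V) (z : V × W) => (-ι z.2 y, δ y z.1))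
      (by intro y y' z; ext <;> simp [add_comm])
      (by intro c y z; ext <;> simp)
      (by intro y z z'; ext <;> simp [add_comm])
      (by intro c y z; ext <;> simp))

lemma standardEmbedding_apply (ι : W →L[ℝ] V →L[ℝ] V) (δ : V →L[ℝ] V →L[ℝ] W) (y : V)
    (z : V × W) : standardEmbedding ι δ y z = (-ι z.2 y, δ y z.1) :=
  rfl

variable {T : V →L[ℝ] V →L[ℝ] V →L[ℝ] V}

lemma commutator_standardEmbedding {ι : W →L[ℝ] V →L[ℝ] V} {δ : V →L[ℝ] V →L[ℝ] W}
    (hι : Function.Injective ι) (hδ : ∀ x w, ι (δ x w) = T x w)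
    (hder : ∀ A, ι A ∈ tripleDerivations T) (hanti : ∀ x w z, T x w z = -T w x z)
    (hcyc : ∀ x w z, T x w z + T w z x + T z x w = 0) (x w y : V) :
    commutatorCLM (commutatorCLM (standardEmbedding ι δ x) (standardEmbedding ι δ w))
      (standardEmbedding ι δ y) = standardEmbedding ι δ (T x w y) := by
  have h1 : ∀ z, ((commutatorCLM (standardEmbedding ι δ x) (standardEmbedding ι δ w)) z).1 =
      T x w z.1 := by
    intro z
    simp only [commutatorCLM_apply, _root_.sub_apply, mul_apply_eq_comp, standardEmbedding_apply,
      Prod.fst_sub, hδ]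
    have := hcyc x w z.1
    rw [hanti z.1 x w] at this
    rw [← sub_eq_zero, ← neg_eq_zero, ← this]
    abel
  have h2 : ∀ z v, ι ((commutatorCLM (standardEmbedding ι δ x) (standardEmbedding ι δ w)) z).2 v =
      T x w (ι z.2 v) - ι z.2 (T x w v) := by
    intro z v
    simp only [commutatorCLM_apply, _root_.sub_apply, mul_apply_eq_comp, standardEmbedding_apply,
      Prod.snd_sub, map_neg, map_sub, _root_.neg_apply, hδ]
    rw [hder z.2 x w v, hanti _ w v]
    abel
  refine ContinuousLinearMap.ext fun z => ?_
  rw [commutatorCLM_apply, _root_.sub_apply, mul_apply_eq_comp, mul_apply_eq_comp]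
  refine Prod.ext ?_ (hι (ContinuousLinearMap.ext fun v => ?_))
  · rw [Prod.fst_sub, h1]
    simp only [standardEmbedding_apply, h2, map_neg]
    abel
  · rw [Prod.snd_sub, map_sub, _root_.sub_apply, h2]
    simp only [standardEmbedding_apply, hδ, h1]
    have := hder (δ x w) y z.1 v
    rw [hδ] at this
    rw [this]
    abel

lemma map_cotSeries_apply_of_map_apply_eq_zero {κ : V →L[ℝ] V} (hκ : ‖(-4 : ℝ) • κ‖ < 1)
    {l : V →L[ℝ] ℝ} (hl : ∀ x, l (κ x) = 0) (x : V) : l (cotSeries κ x) = l x := by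
  have hs : Summable fun k : ℕ =>
      (((bernoulli (2 * k) : ℚ) : ℝ) / ((2 * k).factorial : ℝ)) • ((-4 : ℝ) • κ) ^ k :=
    (summable_norm_smul_pow (fun k => abs_bernoulli_div_factorial_le_one (2 * k)) hκ).of_norm
  have h := (l.comp (ContinuousLinearMap.apply ℝ V x)).map_tsum hs
  rw [cotSeries_eq]
  refine h.trans ?_
  rw [tsum_eq_single 0]
  · simp
  · intro k hk
    obtain ⟨k, rfl⟩ := Nat.exists_eq_succ_of_ne_zero hk
    have h2 : l ((((-4 : ℝ) • κ) ^ (k + 1)) x) = 0 := by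
      rw [pow_succ', mul_apply_eq_comp, _root_.smul_apply, map_smul, hl, smul_zero]
    have h3 := congrArg (fun w => (((bernoulli (2 * (k + 1)) : ℚ) : ℝ) /
      ((2 * (k + 1)).factorial : ℝ)) • w) h2
    rw [← map_smul, smul_zero] at h3
    exact h3

lemma differentiable_of_apply_eq {κ : V → V →L[ℝ] V} (hκ : ∀ y x, κ y x = T y x y) :
    Differentiable ℝ κ := by
  have h : ContDiff ℝ 1 κ := by
    refine contDiff_clm_apply_iff.mpr fun x => ?_
    simp only [hκ]
    fun_prop
  exact h.differentiable one_ne_zero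

/-- The vector fields `y ↦ √(κ y) cot √(κ y) a` associated to a Lie triple system with an invariant
definite bilinear form bracket to the inner derivations of the triple system. -/
lemma lieBracket_cotSeries_of_derivations {ι : W →L[ℝ] V →L[ℝ] V} {δ : V →L[ℝ] V →L[ℝ] W}
    (hι : Function.Injective ι) (hδ : ∀ x w, ι (δ x w) = T x w)
    (hder : ∀ A, ι A ∈ tripleDerivations T)
    (hanti : ∀ x w z, T x w z = -T w x z)
    (hcyc : ∀ x w z, T x w z + T w z x + T z x w = 0)
    {κ : V → V →L[ℝ] V} (hκ : ∀ y x, κ y x = T y x y)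
    {B : V →L[ℝ] V →L[ℝ] ℝ} (hB : ∀ u, B u u = 0 → u = 0)
    (hskew : ∀ x w u z, B u (T x w z) = -B (T x w u) z) :
    ∃ ε > 0, ∀ y, ‖y‖ < ε → ‖(-4 : ℝ) • κ y‖ < 1 ∧ ∀ a b,
      VectorField.lieBracket ℝ (fun y => cotSeries (κ y) a) (fun y => cotSeries (κ y) b) y =
        T b a y := by
  have hdiff := differentiable_of_apply_eq hκ
  set ρ := standardEmbedding ι δ with hρ
  have hbr : ∀ x w y, commutatorCLM (commutatorCLM (ρ x) (ρ w)) (ρ y) = ρ (T x w y) :=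
    commutator_standardEmbedding hι hδ hder hanti hcyc
  have hρκ : ∀ y x, ρ (κ y x) = -commutatorCLM (ρ y) (commutatorCLM (ρ y) (ρ x)) := by
    intro y x
    rw [hκ, ← hbr]
    simp only [commutatorCLM_apply]
    noncomm_ring
  have hκ0 : κ 0 = 0 := by
    ext x
    simp [hκ]
  have hev : ∀ᶠ y in nhds (0 : V),
      ‖(-4 : ℝ) • κ y‖ < 1 ∧ ‖commutatorCLM ((2 : ℝ) • ρ y)‖ < 1 := by
    refine Filter.Eventually.and ?_ ?_
    · refine (hdiff.continuous.const_smul (-4 : ℝ)).norm.continuousAt.eventually_lt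
        continuousAt_const ?_
      simp [hκ0]
    · refine (continuous_commutatorCLM.comp
        (ρ.continuous.const_smul (2 : ℝ))).norm.continuousAt.eventually_lt
        continuousAt_const ?_
      change ‖commutatorCLM ((2 : ℝ) • ρ 0)‖ < 1
      rw [map_zero ρ, smul_zero, commutatorCLM_zero, norm_zero]
      exact one_pos
  obtain ⟨ε, hε, hball⟩ := Metric.eventually_nhds_iff.mp hev
  refine ⟨ε, hε, fun y hy => ?_⟩
  have hy' := hball (y := y) (by simpa using hy)
  refine ⟨hy'.1, fun a b => ?_⟩
  have hker := apply_lieBracket_cotSeries hdiff hρκ hy'.1 hy'.2 (hbr b a y).symm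
  set X := VectorField.lieBracket ℝ (fun y => cotSeries (κ y) a) (fun y => cotSeries (κ y) b) y
    with hX
  set u := X - T b a y with hu
  have hρu : ρ u = 0 := by rw [hu, map_sub, hker, sub_self]
  have hTu : ∀ x w, T x w u = 0 := by
    intro x w
    have h := congrArg (fun S => (S ((0 : V), δ x w)).1) hρu
    simpa [hρ, standardEmbedding_apply, hδ] using h
  have hconst : ∀ c v, B u (fderiv ℝ (fun y => cotSeries (κ y) c) y v) = 0 := by
    intro c v
    have hd : DifferentiableAt ℝ (fun y => cotSeries (κ y) c) y :=
      (DifferentiableAt.comp (g := cotSeries) y (differentiableAt_cotSeries hy'.1)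
        (hdiff y)).clm_apply (differentiableAt_const c)
    have he : (fun y => B u (cotSeries (κ y) c)) =ᶠ[nhds y] fun _ => B u c := by
      have : ∀ᶠ z in nhds y, ‖(-4 : ℝ) • κ z‖ < 1 :=
        (hdiff.continuous.const_smul (-4 : ℝ)).norm.continuousAt.eventually_lt
          continuousAt_const hy'.1
      filter_upwards [this] with z hz
      refine map_cotSeries_apply_of_map_apply_eq_zero hz (fun x => ?_) c
      rw [hκ, hskew, hTu]
      simp
    have h1 := ((B u).hasFDerivAt.comp y hd.hasFDerivAt).fderiv
    have h2 := he.fderiv_eq (𝕜 := ℝ)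
    rw [fderiv_const_apply] at h2
    have h3 := congrArg (fun S : V →L[ℝ] ℝ => S v) (h1.symm.trans h2)
    simpa using h3
  have hBu : B u u = 0 := by
    rw [hu, map_sub (B (X - T b a y)), ← hu, hskew, hTu, hX, VectorField.lieBracket, map_sub,
      hconst, hconst]
    simp
  exact sub_eq_zero.mp (hB u hBu)

lemma lieBracket_cotSeries (hder : ∀ x w, T x w ∈ tripleDerivations T)
    (hanti : ∀ x w z, T x w z = -T w x z)
    (hcyc : ∀ x w z, T x w z + T w z x + T z x w = 0)
    {κ : V → V →L[ℝ] V} (hκ : ∀ y x, κ y x = T y x y)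
    {B : V →L[ℝ] V →L[ℝ] ℝ} (hB : ∀ u, B u u = 0 → u = 0)
    (hskew : ∀ x w u z, B u (T x w z) = -B (T x w u) z) :
    ∃ ε > 0, ∀ y, ‖y‖ < ε → ‖(-4 : ℝ) • κ y‖ < 1 ∧ ∀ a b,
      VectorField.lieBracket ℝ (fun y => cotSeries (κ y) a) (fun y => cotSeries (κ y) b) y =
        T b a y := by
  let δ : V →L[ℝ] V →L[ℝ] tripleDerivations T := LinearMap.toContinuousBilinearMap
    (LinearMap.mk₂ ℝ (fun x w => (⟨T x w, hder x w⟩ : tripleDerivations T))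
      (by intro y y' z; ext; simp)
      (by intro c y z; ext; simp)
      (by intro y z z'; ext; simp)
      (by intro c y z; ext; simp))
  exact lieBracket_cotSeries_of_derivations (W := tripleDerivations T)
    (ι := (tripleDerivations T).subtypeL) (δ := δ) Subtype.val_injective (fun _ _ => rfl)
    (fun A => A.2) hanti hcyc hκ hB hskew

lemma fderiv_cotSeries_apply_derivation {κ : V → V →L[ℝ] V} (hκ : ∀ y x, κ y x = T y x y)
    {S : V →L[ℝ] V} (hS : S ∈ tripleDerivations T) {y : V} (hy : ‖(-4 : ℝ) • κ y‖ < 1) (a : V) :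
    fderiv ℝ (fun y => cotSeries (κ y) a) y (S y) =
      S (cotSeries (κ y) a) - cotSeries (κ y) (S a) := by
  have hdiff := differentiable_of_apply_eq hκ
  have h1 : fderiv ℝ κ y (S y) = S * κ y - κ y * S := by
    ext x
    have h2 : HasFDerivAt (fun y => κ y x) ((ContinuousLinearMap.apply ℝ V x).comp
        (fderiv ℝ κ y)) y :=
      (ContinuousLinearMap.apply ℝ V x).hasFDerivAt.comp y (hdiff y).hasFDerivAt
    have h3 : HasFDerivAt (fun y => T y x y)
        (T y x + ((T.flip x).flip y)) y := by
      have h4 : HasFDerivAt (fun y => T.flip x y) (T.flip x) y := (T.flip x).hasFDerivAt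
      exact h4.clm_apply (hasFDerivAt_id y)
    simp only [hκ] at h2
    have h5 := congrArg (fun M : V →L[ℝ] V => M (S y)) (h2.unique h3)
    simp only [ContinuousLinearMap.comp_apply, ContinuousLinearMap.apply_apply,
      _root_.add_apply, ContinuousLinearMap.flip_apply] at h5
    rw [h5, _root_.sub_apply, mul_apply_eq_comp, mul_apply_eq_comp, hκ, hκ, hS]
    abel
  have h0 : HasFDerivAt (fun y => cotSeries (κ y))
      ((fderiv ℝ cotSeries (κ y)).comp (fderiv ℝ κ y)) y :=
    HasFDerivAt.comp (g := cotSeries) y (differentiableAt_cotSeries hy).hasFDerivAt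
      (hdiff y).hasFDerivAt
  have h6 : HasFDerivAt (fun y => cotSeries (κ y) a) ((ContinuousLinearMap.apply ℝ V a).comp
      ((fderiv ℝ cotSeries (κ y)).comp (fderiv ℝ κ y))) y :=
    (ContinuousLinearMap.apply ℝ V a).hasFDerivAt.comp y h0
  rw [h6.fderiv, ContinuousLinearMap.comp_apply, ContinuousLinearMap.comp_apply, h1,
    fderiv_cotSeries_commutator hy]
  rfl

end LieTripleSystem

section CurvatureTensor

variable {m ι : Type*} [Fintype m] [DecidableEq m] [Fintype ι]

/-- A square matrix as a bounded operator. -/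
noncomputable def mulVecCLM (M : Matrix m m ℝ) : (m → ℝ) →L[ℝ] (m → ℝ) :=
  LinearMap.toContinuousLinearMap (Matrix.toLin' M)

@[simp]
lemma mulVecCLM_apply (M : Matrix m m ℝ) (x : m → ℝ) : mulVecCLM M x = M *ᵥ x :=
  rfl

lemma cotSeries_mulVecCLM (M : Matrix m m ℝ) (x : m → ℝ) : cotSeries (mulVecCLM M) x =
    (∑' k : ℕ, ((-4 : ℝ) ^ k * ((bernoulli (2 * k) : ℚ) : ℝ) / (Nat.factorial (2 * k))) •
      M ^ k) *ᵥ x := by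
  let e : Matrix m m ℝ ≃L[ℝ] ((m → ℝ) →L[ℝ] (m → ℝ)) :=
    (Matrix.toLin'.trans LinearMap.toContinuousLinearMap).toContinuousLinearEquiv
  have he : ∀ M : Matrix m m ℝ, e M = mulVecCLM M := fun _ => rfl
  have hpow : ∀ k : ℕ, mulVecCLM (M ^ k) = mulVecCLM M ^ k := by
    intro k
    induction k with
    | zero => ext; simp
    | succ k ih =>
      rw [pow_succ, pow_succ, ← ih]
      ext
      simp
  have h := e.map_tsum (L := .unconditional ℕ) (f := fun k : ℕ =>
    ((-4 : ℝ) ^ k * ((bernoulli (2 * k) : ℚ) : ℝ) / (Nat.factorial (2 * k))) • M ^ k)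
  have hterm : ∀ (c : ℝ) (k : ℕ), mulVecCLM (c • M ^ k) = c • mulVecCLM M ^ k := by
    intro c k
    rw [← hpow]
    ext
    simp [smul_mulVec]
  simp only [he, hterm] at h
  rw [← mulVecCLM_apply, h, cotSeries]

/-- The operator `∑ i, E i (x, w) D i`. -/
noncomputable def curvatureCLM (E D : ι → Matrix m m ℝ) :
    (m → ℝ) →L[ℝ] (m → ℝ) →L[ℝ] (m → ℝ) →L[ℝ] (m → ℝ) :=
  LinearMap.toContinuousBilinearMap
    (LinearMap.mk₂ ℝ (fun x w => ∑ i, (x ⬝ᵥ E i *ᵥ w) • mulVecCLM (D i))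
      (by intro x x' w; simp [add_dotProduct, add_smul, Finset.sum_add_distrib])
      (by intro c x w; simp [Finset.smul_sum, smul_smul])
      (by intro x w w'; simp [mulVec_add, dotProduct_add, add_smul, Finset.sum_add_distrib])
      (by intro c x w; simp [mulVec_smul, Finset.smul_sum, smul_smul]))

lemma curvatureCLM_apply (E D : ι → Matrix m m ℝ) (x w z : m → ℝ) :
    curvatureCLM E D x w z = ∑ i, (x ⬝ᵥ E i *ᵥ w) • D i *ᵥ z := by
  change (∑ i, (x ⬝ᵥ E i *ᵥ w) • mulVecCLM (D i)) z = _
  simp [_root_.sum_apply]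

omit [DecidableEq m] in
lemma dotProduct_mulVec_of_transpose_eq_neg {M : Matrix m m ℝ} (hM : Mᵀ = -M) (x w : m → ℝ) :
    x ⬝ᵥ M *ᵥ w = -(M *ᵥ x ⬝ᵥ w) := by
  rw [dotProduct_mulVec, ← mulVec_transpose, hM, neg_mulVec, neg_dotProduct]

variable {E D : ι → Matrix m m ℝ}

lemma curvatureCLM_antisymm (hE : ∀ i, (E i)ᵀ = -E i) (x w z : m → ℝ) :
    curvatureCLM E D x w z = -curvatureCLM E D w x z := by
  rw [curvatureCLM_apply, curvatureCLM_apply, ← Finset.sum_neg_distrib]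
  refine Finset.sum_congr rfl fun i _ => ?_
  rw [dotProduct_mulVec_of_transpose_eq_neg (hE i), dotProduct_comm, neg_smul]

lemma dotProduct_curvatureCLM (hD : ∀ i, (D i)ᵀ = -D i) (x w u z : m → ℝ) :
    u ⬝ᵥ curvatureCLM E D x w z = -(curvatureCLM E D x w u ⬝ᵥ z) := by
  rw [curvatureCLM_apply, curvatureCLM_apply, dotProduct_sum, sum_dotProduct,
    ← Finset.sum_neg_distrib]
  refine Finset.sum_congr rfl fun i _ => ?_
  rw [dotProduct_smul, dotProduct_mulVec_of_transpose_eq_neg (hD i), smul_dotProduct, smul_neg]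

lemma curvatureCLM_single (E D : ι → Matrix m m ℝ) (a b : m) (z : m → ℝ) :
    curvatureCLM E D (Pi.single a 1) (Pi.single b 1) z = ∑ i, E i a b • D i *ᵥ z := by
  rw [curvatureCLM_apply]
  simp

/-- If the `D k` span a Lie algebra acting compatibly on the `E i`, then each `D k` is a derivation
of the curvature. -/
lemma mulVecCLM_mem_tripleDerivations {F : ι → ι → ι → ℝ} (hDt : ∀ i, (D i)ᵀ = -D i)
    (hcomm : ∀ i k, D i * D k - D k * D i = ∑ j, F j i k • D j)
    (hsym : ∀ i k, E i * D k - D k * E i = ∑ j, F i k j • E j) (k : ι) :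
    mulVecCLM (D k) ∈ tripleDerivations (curvatureCLM E D) := by
  intro x w z
  have h1 : ∀ i, D k *ᵥ (D i *ᵥ z) = D i *ᵥ (D k *ᵥ z) + ∑ j, F j k i • D j *ᵥ z := by
    intro i
    have h := congrArg (fun M : Matrix m m ℝ => M *ᵥ z) (hcomm k i)
    simp only [sub_mulVec, ← mulVec_mulVec, sum_mulVec, smul_mulVec] at h
    rw [← h]
    abel
  have h2 : ∀ i, D k *ᵥ x ⬝ᵥ E i *ᵥ w + x ⬝ᵥ E i *ᵥ (D k *ᵥ w) =
      ∑ j, F i k j * (x ⬝ᵥ E j *ᵥ w) := by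
    intro i
    have h := congrArg (fun M : Matrix m m ℝ => x ⬝ᵥ M *ᵥ w) (hsym i k)
    simp only [sub_mulVec, ← mulVec_mulVec, sum_mulVec, smul_mulVec, dotProduct_sub,
      dotProduct_sum, dotProduct_smul, smul_eq_mul] at h
    rw [← h, dotProduct_mulVec_of_transpose_eq_neg (hDt k) x]
    ring
  simp only [mulVecCLM_apply, curvatureCLM_apply, mulVec_sum, mulVec_smul]
  simp only [h1, smul_add, Finset.sum_add_distrib]
  rw [← Finset.sum_add_distrib (f := fun i => (D k *ᵥ x ⬝ᵥ E i *ᵥ w) • D i *ᵥ z), add_comm]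
  congr 1
  simp only [← add_smul, h2, Finset.smul_sum, Finset.sum_smul, smul_smul]
  rw [Finset.sum_comm]
  simp only [mul_comm]

lemma curvatureCLM_mem_tripleDerivations {F : ι → ι → ι → ℝ} (hDt : ∀ i, (D i)ᵀ = -D i)
    (hcomm : ∀ i k, D i * D k - D k * D i = ∑ j, F j i k • D j)
    (hsym : ∀ i k, E i * D k - D k * E i = ∑ j, F i k j • E j) (x w : m → ℝ) :
    curvatureCLM E D x w ∈ tripleDerivations (curvatureCLM E D) :=
  Submodule.sum_mem _ fun i _ => Submodule.smul_mem _ _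
    (mulVecCLM_mem_tripleDerivations hDt hcomm hsym i)

variable {lam : ι → ℝ} {R : m → m → m → m → ℝ}

lemma curvatureCLM_apply_apply (hD : ∀ i, D i = -(lam i) • E i)
    (hR : ∀ a b c d, R a b c d = ∑ i, lam i * E i a b * E i c d) (x w z : m → ℝ) (a : m) :
    curvatureCLM E D x w z a = -∑ b, ∑ c, ∑ d, R a b c d * (z b * x c * w d) := by
  have h1 : ∀ i, (x ⬝ᵥ E i *ᵥ w) * (E i *ᵥ z) a =
      ∑ b, ∑ c, ∑ d, E i a b * E i c d * (z b * x c * w d) := by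
    intro i
    simp only [mulVec, dotProduct]
    rw [mul_comm, Finset.sum_mul]
    refine Finset.sum_congr rfl fun b _ => ?_
    rw [Finset.mul_sum]
    refine Finset.sum_congr rfl fun c _ => ?_
    rw [Finset.mul_sum, Finset.mul_sum]
    refine Finset.sum_congr rfl fun d _ => ?_
    ring
  rw [curvatureCLM_apply, Finset.sum_apply]
  simp only [hD, Pi.smul_apply, smul_mulVec, smul_eq_mul, mul_neg, Finset.sum_neg_distrib,
    mul_left_comm _ (lam _), h1, hR, Finset.sum_mul, neg_mulVec, neg_smul, Pi.neg_apply]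
  congr 1
  simp only [Finset.mul_sum]
  rw [Finset.sum_comm]
  refine Finset.sum_congr rfl fun b _ => ?_
  rw [Finset.sum_comm]
  refine Finset.sum_congr rfl fun c _ => ?_
  rw [Finset.sum_comm]
  refine Finset.sum_congr rfl fun d _ => Finset.sum_congr rfl fun i _ => ?_
  ring

lemma curvatureCLM_cyclic (hD : ∀ i, D i = -(lam i) • E i)
    (hR : ∀ a b c d, R a b c d = ∑ i, lam i * E i a b * E i c d)
    (hBianchi : ∀ a b c d, R a b c d + R a c d b + R a d b c = 0) (x w z : m → ℝ) :
    curvatureCLM E D x w z + curvatureCLM E D w z x + curvatureCLM E D z x w = 0 := by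
  ext a
  have h1 : ∑ b, ∑ c, ∑ d, R a b c d * (x b * w c * z d) =
      ∑ b, ∑ c, ∑ d, R a c d b * (z b * x c * w d) := by
    rw [Finset.sum_comm_cycle]
    refine Finset.sum_congr rfl fun b _ => Finset.sum_congr rfl fun c _ =>
      Finset.sum_congr rfl fun d _ => ?_
    ring
  have h2 : ∑ b, ∑ c, ∑ d, R a b c d * (w b * z c * x d) =
      ∑ b, ∑ c, ∑ d, R a d b c * (z b * x c * w d) := by
    rw [← Finset.sum_comm_cycle]
    refine Finset.sum_congr rfl fun b _ => Finset.sum_congr rfl fun c _ =>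
      Finset.sum_congr rfl fun d _ => ?_
    ring
  simp only [Pi.add_apply, curvatureCLM_apply_apply hD hR, Pi.zero_apply]
  rw [h1, h2, ← neg_add, ← neg_add, neg_eq_zero]
  simp only [← Finset.sum_add_distrib, ← add_mul, hBianchi, zero_mul, Finset.sum_const_zero]

lemma mulVec_eq_curvatureCLM (hE : ∀ i, (E i)ᵀ = -E i) (hD : ∀ i, D i = -(lam i) • E i)
    (hR : ∀ a b c d, R a b c d = ∑ i, lam i * E i a b * E i c d) {y : m → ℝ} {K : Matrix m m ℝ}
    (hK : ∀ a b, K a b = ∑ c, ∑ d, R a c b d * y c * y d) (x : m → ℝ) :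
    K *ᵥ x = curvatureCLM E D y x y := by
  rw [curvatureCLM_antisymm hE]
  ext a
  rw [Pi.neg_apply, curvatureCLM_apply_apply hD hR, neg_neg, mulVec, dotProduct]
  simp only [hK, Finset.sum_mul]
  rw [Finset.sum_comm]
  refine Finset.sum_congr rfl fun b _ => Finset.sum_congr rfl fun c _ =>
    Finset.sum_congr rfl fun d _ => ?_
  ring

end CurvatureTensor

/-- The Killing vector fields `P_a = (√K cot √K)^b{}_a ∂_b` (translations) and
`L_i = -(D_i)_{ba} y^a ∂_b` (rotations) in normal coordinates on a symmetric space
form a representation of the curvature algebra: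
`[P_a, P_b] = E^i_{ab} L_i`, `[L_i, P_a] = (D_i)_{ba} P_b`, `[L_i, L_k] = F^j_{ik} L_j`,
on a small ball around the origin. -/
theorem killing_fields_curvature_algebra
    (n p : ℕ) (hn : 0 < n) (hp : 0 < p)
    (lam : Fin p → ℝ) (hlam : ∀ i, lam i ≠ 0)
    (E : Fin p → Matrix (Fin n) (Fin n) ℝ)
    (hanti : ∀ i, (E i)ᵀ = -(E i))
    (D : Fin p → Matrix (Fin n) (Fin n) ℝ)
    (hD : ∀ i, D i = -(lam i) • E i)
    (F : Fin p → Fin p → Fin p → ℝ)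
    (hcomm : ∀ i k, D i * D k - D k * D i = ∑ j, F j i k • D j)
    (hsym : ∀ i k a b, ∑ c, (E i a c * D k c b - E i b c * D k c a) = ∑ j, F i k j * E j a b)
    (R : Fin n → Fin n → Fin n → Fin n → ℝ)
    (hR : ∀ a b c d, R a b c d = ∑ i, lam i * E i a b * E i c d)
    (hBianchi : ∀ a b c d, R a b c d + R a c d b + R a d b c = 0)
    (K : (Fin n → ℝ) → Matrix (Fin n) (Fin n) ℝ)
    (hK : ∀ y a b, K y a b = ∑ c, ∑ d, R a c b d * y c * y d)
    (P : Fin n → (Fin n → ℝ) → (Fin n → ℝ))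
    (hP : ∀ a y, P a y =
      (∑' k : ℕ, (((-4:ℝ)^k * ((bernoulli (2*k) : ℚ) : ℝ) / (Nat.factorial (2*k))) • (K y)^k)).mulVec
        (Pi.single a 1))
    (L : Fin p → (Fin n → ℝ) → (Fin n → ℝ))
    (hL : ∀ i y, L i y = -(D i).mulVec y) :
    ∃ ε > 0, ∀ y : Fin n → ℝ, ‖y‖ < ε →
      (∀ a b, fderiv ℝ (P b) y (P a y) - fderiv ℝ (P a) y (P b y) = ∑ i, E i a b • L i y) ∧
      (∀ i a, fderiv ℝ (P a) y (L i y) - fderiv ℝ (L i) y (P a y) = ∑ b, D i b a • P b y) ∧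
      (∀ i k, fderiv ℝ (L k) y (L i y) - fderiv ℝ (L i) y (L k y) = ∑ j, F j i k • L j y) := by
  have hE : ∀ i, (E i)ᵀ = -E i := hanti
  have hDt : ∀ i, (D i)ᵀ = -D i := by
    intro i
    rw [hD, transpose_smul, hE, smul_neg]
  have hsym' : ∀ i k, E i * D k - D k * E i = ∑ j, F i k j • E j := by
    intro i k
    ext a b
    have h : D k * E i = (E i * D k)ᵀ := by
      rw [transpose_mul, hE, hDt, neg_mul_neg]
    rw [h, Matrix.sum_apply]
    simp only [Matrix.sub_apply, Matrix.transpose_apply, Matrix.mul_apply, Matrix.smul_apply,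
      smul_eq_mul, ← Finset.sum_sub_distrib]
    exact hsym i k a b
  have hκ : ∀ y x, mulVecCLM (K y) x = curvatureCLM E D y x y := fun y x =>
    mulVec_eq_curvatureCLM hE hD hR (hK y) x
  have hPc : ∀ a, P a = fun y => cotSeries (mulVecCLM (K y)) (Pi.single a 1) := by
    intro a
    funext y
    rw [hP, cotSeries_mulVecCLM]
  have hLc : ∀ i, L i = ⇑(-mulVecCLM (D i)) := by
    intro i
    funext y
    rw [hL]
    rfl
  let B : (Fin n → ℝ) →L[ℝ] (Fin n → ℝ) →L[ℝ] ℝ :=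
    LinearMap.toContinuousBilinearMap (dotProductBilin ℝ ℝ)
  have hB : ∀ u v, B u v = u ⬝ᵥ v := fun _ _ => rfl
  obtain ⟨ε, hε, h⟩ := lieBracket_cotSeries
    (curvatureCLM_mem_tripleDerivations hDt hcomm hsym') (curvatureCLM_antisymm hE)
    (curvatureCLM_cyclic hD hR hBianchi) hκ
    (B := B) (fun u hu => dotProduct_self_eq_zero.mp ((hB u u).symm.trans hu))
    (dotProduct_curvatureCLM hDt)
  refine ⟨ε, hε, fun y hy => ⟨fun a b => ?_, fun i a => ?_, fun i k => ?_⟩⟩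
  · have hab := (h y hy).2 (Pi.single a 1) (Pi.single b 1)
    rw [VectorField.lieBracket, ← hPc, ← hPc, curvatureCLM_antisymm hE, curvatureCLM_single] at hab
    rw [congrFun (hPc a) y, congrFun (hPc b) y, hab, ← Finset.sum_neg_distrib]
    simp only [hL, smul_neg]
  · have hd := fderiv_cotSeries_apply_derivation hκ
      (mulVecCLM_mem_tripleDerivations hDt hcomm hsym' i) (h y hy).1 (Pi.single a 1)
    have hcol : mulVecCLM (D i) (Pi.single a 1) = ∑ b, D i b a • Pi.single b (1 : ℝ) := by
      ext c
      simp [Pi.single_apply]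
    rw [← hPc] at hd
    rw [hLc, (-mulVecCLM (D i)).fderiv, _root_.neg_apply, _root_.neg_apply, map_neg, hd, hcol]
    simp only [hPc, map_sum, map_smul]
    abel
  · rw [hLc, hLc, (-mulVecCLM (D i)).fderiv, (-mulVecCLM (D k)).fderiv]
    have hc := congrArg (fun M : Matrix (Fin n) (Fin n) ℝ => M *ᵥ y) (hcomm i k)
    simp only [sub_mulVec, ← mulVec_mulVec, sum_mulVec, smul_mulVec] at hc
    simp only [_root_.neg_apply, map_neg, neg_neg, mulVecCLM_apply, hL, smul_neg,
      Finset.sum_neg_distrib, ← hc]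
    abel
end

section
/- Let V be a vector space, n, p positive integers, E¹, …, E^p antisymmetric real n×n matrices, D_1, …, D_p real n×n matrices, Fʲ_{ik} real constants, and T_1, …, T_p, and B_{ab} (a,b = 1,…,n) endomorphisms of V. Assume: (i) [T_i, T_k] = Σ_j Fʲ_{ik} T_j; (ii) Σ_c (Eⁱ_{ac}(D_k)_{cb} − Eⁱ_{bc}(D_k)_{ca}) = Σ_j Fⁱ_{kj} Eʲ_{ab}; (iii) B_{ab} = −B_{ba}, [B_{ab}, T_i] = 0, [B_{ab}, B_{cd}] = 0; (iv) Σ_c (D_i)_{ca}·B_{cb} = 0 for all i, a, b. Define R^f{}_{acd} := −Σ_i (D_i)_{fa}·Eⁱ_{cd} and 𝓕_{ab} := −Σ_i Eⁱ_{ab}·T_i + B_{ab}. Then 𝓕 satisfies the integrability constraint of a homogeneous bundle: [𝓕_{cd}, 𝓕_{ab}] − Σ_f R^f{}_{acd}·𝓕_{fb} − Σ_f R^f{}_{bcd}·𝓕_{af} = 0 for all a, b, c, d. -/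
open Matrix BigOperators

/-- The two-form `𝓕_{ab} = -E^i_{ab} T_i + B_{ab}` built from a representation `T_i` of the
holonomy algebra and an Abelian part `B_{ab}` supported on the flat directions satisfies the
integrability constraint `[𝓕_{cd}, 𝓕_{ab}] - R^f_{acd} 𝓕_{fb} - R^f_{bcd} 𝓕_{af} = 0`
of a homogeneous vector bundle over a symmetric space. -/
theorem homogeneous_bundle_curvature
    (n p : ℕ) (hn : 0 < n) (hp : 0 < p)
    (V : Type*) [AddCommGroup V] [Module ℝ V]
    (E : Fin p → Matrix (Fin n) (Fin n) ℝ)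
    (hanti : ∀ i, (E i)ᵀ = -(E i))
    (D : Fin p → Matrix (Fin n) (Fin n) ℝ)
    (F : Fin p → Fin p → Fin p → ℝ)
    (T : Fin p → Module.End ℝ V)
    (B : Fin n → Fin n → Module.End ℝ V)
    (hT : ∀ i k, T i * T k - T k * T i = ∑ j, F j i k • T j)
    (hsym : ∀ i k a b, ∑ c, (E i a c * D k c b - E i b c * D k c a) = ∑ j, F i k j * E j a b)
    (hBanti : ∀ a b, B a b = -B b a)
    (hBT : ∀ a b i, B a b * T i = T i * B a b)
    (hBB : ∀ a b c d, B a b * B c d = B c d * B a b)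
    (hDB : ∀ i a b, ∑ c, D i c a • B c b = 0)
    (R : Fin n → Fin n → Fin n → Fin n → ℝ)
    (hR : ∀ f a c d, R f a c d = -∑ i, D i f a * E i c d)
    (𝓕 : Fin n → Fin n → Module.End ℝ V)
    (h𝓕 : ∀ a b, 𝓕 a b = -(∑ i, E i a b • T i) + B a b) :
    ∀ a b c d, 𝓕 c d * 𝓕 a b - 𝓕 a b * 𝓕 c d
      - ∑ f, R f a c d • 𝓕 f b - ∑ f, R f b c d • 𝓕 a f = 0 := by
  intro a b c d
  have hE : ∀ i x y, E i x y = -E i y x := fun i x y => by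
    simpa using congrFun (congrFun (hanti i) y) x
  have hB : ∀ x y (e : Fin p → ℝ), B x y * (∑ i, e i • T i) = (∑ i, e i • T i) * B x y := by
    intro x y e
    simp [Finset.mul_sum, Finset.sum_mul, hBT]
  have hcomm : 𝓕 c d * 𝓕 a b - 𝓕 a b * 𝓕 c d
      = ∑ k, E k c d • ∑ j, (∑ i, F j k i * E i a b) • T j := by
    have hsplit : 𝓕 c d * 𝓕 a b - 𝓕 a b * 𝓕 c d
        = (∑ k, E k c d • T k) * (∑ i, E i a b • T i)
          - (∑ i, E i a b • T i) * (∑ k, E k c d • T k) := by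
      rw [h𝓕, h𝓕]
      simp only [add_mul, mul_add, neg_mul, mul_neg, hB, hBB c d a b]
      abel
    rw [hsplit, Finset.sum_mul, Finset.mul_sum, ← Finset.sum_sub_distrib]
    refine Finset.sum_congr rfl fun k _ => ?_
    rw [smul_mul_assoc, mul_smul_comm, ← smul_sub, Finset.mul_sum, Finset.sum_mul,
      ← Finset.sum_sub_distrib]
    congr 1
    simp only [smul_mul_assoc, mul_smul_comm, ← smul_sub, hT, Finset.smul_sum, Finset.sum_smul]
    rw [Finset.sum_comm]
    simp only [smul_smul, mul_comm]
  have hact : ∀ k, ∑ f, D k f a • 𝓕 f b + ∑ f, D k f b • 𝓕 a f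
      = -∑ j, (∑ i, F j k i * E i a b) • T j := by
    intro k
    have hleft : ∑ f, D k f a • 𝓕 f b = ∑ j, (∑ f, E j b f * D k f a) • T j := by
      simp only [h𝓕, smul_add, Finset.sum_add_distrib, hDB, add_zero, Finset.sum_smul]
      rw [Finset.sum_comm]
      refine Finset.sum_congr rfl fun f _ => ?_
      rw [← Finset.sum_neg_distrib, Finset.smul_sum]
      refine Finset.sum_congr rfl fun j _ => ?_
      rw [hE j b f, ← neg_smul, smul_smul, mul_comm]
    have hflat : ∑ f, D k f b • B a f = 0 := by
      rw [← neg_eq_zero, ← Finset.sum_neg_distrib, ← hDB k b a]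
      refine Finset.sum_congr rfl fun f _ => ?_
      rw [hBanti a f, smul_neg, neg_neg]
    have hright : ∑ f, D k f b • 𝓕 a f = -∑ j, (∑ f, E j a f * D k f b) • T j := by
      simp only [h𝓕, smul_add, Finset.sum_add_distrib, hflat, add_zero, Finset.sum_smul]
      rw [Finset.sum_comm, ← Finset.sum_neg_distrib]
      refine Finset.sum_congr rfl fun f _ => ?_
      rw [smul_neg, Finset.smul_sum]
      congr 1
      refine Finset.sum_congr rfl fun j _ => ?_
      rw [smul_smul, mul_comm]
    simp only [hleft, hright, ← hsym, Finset.sum_sub_distrib, sub_smul]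
    abel
  have hcurv : ∀ x (G : Fin n → Module.End ℝ V),
      ∑ f, R f x c d • G f = -∑ k, E k c d • ∑ f, D k f x • G f := by
    intro x G
    simp only [hR, neg_smul, Finset.sum_neg_distrib, Finset.sum_smul, Finset.smul_sum, smul_smul]
    rw [Finset.sum_comm]
    simp only [mul_comm]
  rw [hcomm, hcurv a fun f => 𝓕 f b, hcurv b fun f => 𝓕 a f, sub_neg_eq_add, sub_neg_eq_add,
    add_assoc, ← Finset.sum_add_distrib, ← Finset.sum_add_distrib]
  refine Finset.sum_eq_zero fun k _ => ?_
  rw [← smul_add, hact, smul_neg, add_neg_cancel]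
end

section
/- Let N be a positive integer, C^C{}_{AB} real constants, B_{AB} an antisymmetric real N×N matrix, and X_A (A = 1,…,N) smooth vector fields on an open set U ⊆ ℝᴺ with components X_A{}^M(k). Assume: (i) [X_A, X_B] = Σ_C C^C{}_{AB}·X_C on U; (ii) Σ_C C^C{}_{AB}·B_{CM} = 0 for all A, B, M; (iii) Σ_M X_A{}^M(k)·B_{MB} = B_{AB} for all A, B and all k ∈ U. Define first-order differential operators J_A on smooth functions f on U by (J_A f)(k) := Σ_M X_A{}^M(k)·∂_M f(k) − (1/2)·(Σ_M B_{AM} k^M)·f(k). Then for all A, B and all smooth f: [J_A, J_B] f = Σ_C C^C{}_{AB}·J_C f + B_{AB}·f. -/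
open Matrix BigOperators

/-- The covariant right-invariant vector field `J_A = X_A - (1/2) B_{AM} k^M` as a
first-order differential operator on functions. -/
noncomputable def Jop {N : ℕ} (XA : Fin N → (Fin N → ℝ) → Fin N → ℝ)
    (Bm : Matrix (Fin N) (Fin N) ℝ) (A : Fin N)
    (f : (Fin N → ℝ) → ℝ) (k : Fin N → ℝ) : ℝ :=
  (∑ M, XA A k M * fderiv ℝ f k (Pi.single M 1))
    - (1/2 : ℝ) * (∑ M, Bm A M * k M) * f k

/-- The partial derivatives of `g` contracted with `v` give the derivative of `g` along `v`. -/
theorem sum_mul_fderiv_single {N : ℕ} (g : (Fin N → ℝ) → ℝ) (k v : Fin N → ℝ) :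
    ∑ M, v M * fderiv ℝ g k (Pi.single M 1) = fderiv ℝ g k v := by
  conv_rhs => rw [pi_eq_sum_univ' v]
  simp [map_sum, map_smul, Pi.single]

theorem Jop_eq_fderiv {N : ℕ} (XA : Fin N → (Fin N → ℝ) → Fin N → ℝ)
    (Bm : Matrix (Fin N) (Fin N) ℝ) (A : Fin N) (f : (Fin N → ℝ) → ℝ) :
    Jop XA Bm A f = fun k => fderiv ℝ f k (XA A k) - (1/2 : ℝ) * (Bm A ⬝ᵥ k) * f k := by
  funext k
  rw [Jop, sum_mul_fderiv_single]
  rfl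

theorem fderiv_Jop_apply {N : ℕ} (XA : Fin N → (Fin N → ℝ) → Fin N → ℝ)
    (Bm : Matrix (Fin N) (Fin N) ℝ) (A : Fin N) {f : (Fin N → ℝ) → ℝ} {k : Fin N → ℝ}
    (hf : DifferentiableAt ℝ f k) (hf' : DifferentiableAt ℝ (fderiv ℝ f) k)
    (hX : DifferentiableAt ℝ (XA A) k) (v : Fin N → ℝ) :
    fderiv ℝ (Jop XA Bm A f) k v =
      fderiv ℝ (fderiv ℝ f) k v (XA A k) + fderiv ℝ f k (fderiv ℝ (XA A) k v)
        - (1/2 : ℝ) * ((Bm A ⬝ᵥ v) * f k + (Bm A ⬝ᵥ k) * fderiv ℝ f k v) := by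
  have hb : HasFDerivAt (fun x : Fin N → ℝ => Bm A ⬝ᵥ x)
      (LinearMap.toContinuousLinearMap (dotProductBilin ℝ ℝ (Bm A))) k :=
    (LinearMap.toContinuousLinearMap (dotProductBilin ℝ ℝ (Bm A))).hasFDerivAt
  have h := (hf'.hasFDerivAt.clm_apply hX.hasFDerivAt).sub
    ((hb.const_mul (1/2 : ℝ)).mul hf.hasFDerivAt)
  rw [Jop_eq_fderiv]
  refine (congrArg (fun L => L v) h.fderiv).trans ?_
  simp
  ring

/-- The operators `J_A = X_A - (1/2) B_{AM} k^M` form a representation of the gauged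
curvature algebra with central term `B_{AB}`:
`[J_A, J_B] f = C^C_{AB} J_C f + B_{AB} f`. -/
theorem gauged_algebra_representation
    (N : ℕ) (hN : 0 < N)
    (Cc : Fin N → Fin N → Fin N → ℝ)
    (Bm : Matrix (Fin N) (Fin N) ℝ)
    (hBanti : Bmᵀ = -Bm)
    (U : Set (Fin N → ℝ)) (hU : IsOpen U)
    (XA : Fin N → (Fin N → ℝ) → Fin N → ℝ)
    (hXsmooth : ∀ A, ContDiffOn ℝ (⊤ : ℕ∞) (XA A) U)
    (hXcomm : ∀ k ∈ U, ∀ A B M' : Fin N,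
      ∑ M, (XA A k M * fderiv ℝ (fun k' => XA B k' M') k (Pi.single M 1)
          - XA B k M * fderiv ℝ (fun k' => XA A k' M') k (Pi.single M 1))
        = ∑ C, Cc C A B * XA C k M')
    (hCB : ∀ A B M, ∑ C, Cc C A B * Bm C M = 0)
    (hXB : ∀ k ∈ U, ∀ A B, ∑ M, XA A k M * Bm M B = Bm A B) :
    ∀ A B, ∀ f : (Fin N → ℝ) → ℝ, ContDiff ℝ (⊤ : ℕ∞) f → ∀ k ∈ U,
      Jop XA Bm A (Jop XA Bm B f) k - Jop XA Bm B (Jop XA Bm A f) k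
        = ∑ C, Cc C A B * Jop XA Bm C f k + Bm A B * f k := by
  intro A B f hf k hk
  have hX : ∀ A, DifferentiableAt ℝ (XA A) k := fun A =>
    ((hXsmooth A).contDiffAt (hU.mem_nhds hk)).differentiableAt (by simp)
  have hle : (2 : WithTop ℕ∞) ≤ ((⊤ : ℕ∞) : WithTop ℕ∞) := WithTop.coe_le_coe.2 le_top
  have hf1 : DifferentiableAt ℝ f k := hf.contDiffAt.differentiableAt (by simp)
  have hf2 : DifferentiableAt ℝ (fderiv ℝ f) k :=
    (hf.contDiffAt.fderiv_right (m := 1) (by rwa [one_add_one_eq_two])).differentiableAt (by simp)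
  have hsymm : fderiv ℝ (fderiv ℝ f) k (XA A k) (XA B k)
      = fderiv ℝ (fderiv ℝ f) k (XA B k) (XA A k) :=
    (hf.contDiffAt.isSymmSndFDerivAt (by simpa using hle)) _ _
  have hbracket : fderiv ℝ (XA B) k (XA A k) - fderiv ℝ (XA A) k (XA B k)
      = ∑ C, Cc C A B • XA C k := by
    funext M'
    have h := hXcomm k hk A B M'
    rw [Finset.sum_sub_distrib, sum_mul_fderiv_single, sum_mul_fderiv_single,
      fderiv_apply (hX B), fderiv_apply (hX A)] at h
    simpa using h
  have hflow : fderiv ℝ f k (fderiv ℝ (XA B) k (XA A k))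
      - fderiv ℝ f k (fderiv ℝ (XA A) k (XA B k)) = ∑ C, Cc C A B * fderiv ℝ f k (XA C k) := by
    rw [← map_sub, hbracket]
    simp
  have hanti : ∀ A B, Bm A B = -Bm B A := fun A B => congrFun (congrFun hBanti B) A
  have hdot : ∀ A B, Bm B ⬝ᵥ XA A k = -Bm A B := fun A B => by
    rw [← hXB k hk A B, dotProduct, ← Finset.sum_neg_distrib]
    exact Finset.sum_congr rfl fun M _ => by rw [hanti B M]; ring
  have hcentral : ∑ C, Cc C A B * (Bm C ⬝ᵥ k) = 0 := by
    simp only [dotProduct, Finset.mul_sum]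
    rw [Finset.sum_comm]
    refine Finset.sum_eq_zero fun M _ => ?_
    simp only [← mul_assoc]
    rw [← Finset.sum_mul, hCB, zero_mul]
  have hrhs : ∑ C, Cc C A B * Jop XA Bm C f k = ∑ C, Cc C A B * fderiv ℝ f k (XA C k) := by
    have h : ∀ C, Cc C A B * Jop XA Bm C f k = Cc C A B * fderiv ℝ f k (XA C k)
        - Cc C A B * (Bm C ⬝ᵥ k) * (f k / 2) := fun C => by
      rw [Jop_eq_fderiv]; ring
    simp only [h]
    rw [Finset.sum_sub_distrib, ← Finset.sum_mul, hcentral, zero_mul, sub_zero]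
  rw [hrhs, ← hflow, Jop_eq_fderiv XA Bm A (Jop XA Bm B f), Jop_eq_fderiv XA Bm B (Jop XA Bm A f)]
  dsimp only
  rw [fderiv_Jop_apply XA Bm B hf1 hf2 (hX B), fderiv_Jop_apply XA Bm A hf1 hf2 (hX A),
    hdot, hdot, hanti B A, hsymm, Jop_eq_fderiv, Jop_eq_fderiv]
  ring
end

section
/- Let n, p be positive integers, β a symmetric positive definite real p×p matrix with inverse entries β^{ij}, D_1, …, D_p real n×n matrices, F_1, …, F_p real p×p matrices, V a finite-dimensional real vector space, and 𝓡_1, …, 𝓡_p ∈ End(V). Define the scalar curvature R := −Σ_{i,k} β^{ik}·tr(D_i·D_k), the holonomy scalar curvature R_H := −(1/4)·Σ_{i,k} β^{ik}·tr(F_i·F_k), the Casimir operator 𝓡² := Σ_{i,j} β^{ij}·𝓡_i·𝓡_j, and for ω ∈ ℝᵖ write D(ω) := Σ_i ω^i D_i, F(ω) := Σ_i ω^i F_i, 𝓡(ω) := Σ_i ω^i 𝓡_i. Let ⟨·⟩ denote the Gaussian average ⟨f⟩ := (4π)^{−p/2}(det β)^{1/2} ∫_{ℝᵖ} f(ω)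 exp(−(1/4)ωᵀβω) dω (a Bochner integral for End(V)-valued integrands). Then ⟨ [ R/8 + R_H/6 + (1/48)·tr(F(ω)²) − (1/48)·tr(D(ω)²) ]·Id_V − 𝓡² + (1/2)·𝓡(ω)² ⟩ = (R/6)·Id_V. -/
open Matrix BigOperators MeasureTheory

lemma integral_exp_neg_quarter_sq :
    ∫ x : ℝ, Real.exp (-(1/4 : ℝ) * x ^ 2) = √(4 * Real.pi) := by
  rw [integral_gaussian]
  congr 1
  ring

lemma integral_mul_exp_neg_quarter_sq :
    ∫ x : ℝ, x * Real.exp (-(1/4 : ℝ) * x ^ 2) = 0 := by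
  have h := integral_neg_eq_self (fun x : ℝ => x * Real.exp (-(1/4 : ℝ) * x ^ 2)) volume
  simp only [neg_sq, neg_mul, integral_neg] at h ⊢
  linarith

lemma integral_sq_mul_exp_neg_quarter_sq :
    ∫ x : ℝ, x ^ 2 * Real.exp (-(1/4 : ℝ) * x ^ 2) = 2 * √(4 * Real.pi) := by
  have hv : ∫ x, x ^ 2 ∂(ProbabilityTheory.gaussianReal 0 2) = 2 := by
    rw [← ProbabilityTheory.variance_of_integral_eq_zero (X := fun x : ℝ => x) (by fun_prop)
      (by simp)]
    simp
  rw [ProbabilityTheory.integral_gaussianReal_eq_integral_smul (by norm_num)] at hv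
  have hpos : √(4 * Real.pi) ≠ 0 := by positivity
  have hpdf : ∀ x : ℝ, ProbabilityTheory.gaussianPDFReal 0 2 x • x ^ 2
      = (√(4 * Real.pi))⁻¹ * (x ^ 2 * Real.exp (-(1/4 : ℝ) * x ^ 2)) := by
    intro x
    simp only [ProbabilityTheory.gaussianPDFReal, smul_eq_mul, sub_zero, NNReal.coe_ofNat]
    rw [show 2 * Real.pi * 2 = 4 * Real.pi by ring,
      show -x ^ 2 / (2 * 2) = -(1/4 : ℝ) * x ^ 2 by ring]
    ring
  simp_rw [hpdf] at hv
  rw [integral_const_mul] at hv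
  rw [inv_mul_eq_iff_eq_mul₀ hpos] at hv
  rw [hv, mul_comm]

lemma integrable_pow_mul_exp_neg_quarter_sq (m : ℕ) :
    Integrable fun x : ℝ => x ^ m * Real.exp (-(1/4 : ℝ) * x ^ 2) := by
  have h := integrable_rpow_mul_exp_neg_mul_sq (b := 1/4) (by norm_num) (s := (m : ℝ))
    (by linarith [(Nat.cast_nonneg m : (0 : ℝ) ≤ m)])
  simpa only [Real.rpow_natCast] using h

section StandardGaussian

variable {ι : Type*} [Fintype ι]

lemma prod_pow_mul_exp_neg_quarter_sq (m : ι → ℕ) (x : ι → ℝ) :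
    ∏ i, (x i ^ m i * Real.exp (-(1/4 : ℝ) * x i ^ 2))
      = (∏ i, x i ^ m i) * Real.exp (-(1/4 : ℝ) * (x ⬝ᵥ x)) := by
  rw [Finset.prod_mul_distrib, ← Real.exp_sum, ← Finset.mul_sum]
  simp only [dotProduct, sq]

lemma integrable_standard_gaussian :
    Integrable fun x : ι → ℝ => Real.exp (-(1/4 : ℝ) * (x ⬝ᵥ x)) := by
  have h := Integrable.fintype_prod (ι := ι) (μ := fun _ => (volume : Measure ℝ))
    (fun _ => integrable_pow_mul_exp_neg_quarter_sq 0)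
  simp_rw [prod_pow_mul_exp_neg_quarter_sq (fun _ => 0)] at h
  simp only [pow_zero, Finset.prod_const_one, one_mul] at h
  exact h

lemma integral_standard_gaussian :
    ∫ x : ι → ℝ, Real.exp (-(1/4 : ℝ) * (x ⬝ᵥ x)) = √(4 * Real.pi) ^ Fintype.card ι := by
  have h := integral_fintype_prod_volume_eq_pow (ι := ι)
    (fun x : ℝ => x ^ 0 * Real.exp (-(1/4 : ℝ) * x ^ 2))
  simp_rw [prod_pow_mul_exp_neg_quarter_sq (fun _ => 0)] at h
  simp only [pow_zero, Finset.prod_const_one, one_mul, integral_exp_neg_quarter_sq] at h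
  exact h

variable [DecidableEq ι]

lemma prod_pow_indicator_add (k l : ι) (x : ι → ℝ) :
    ∏ i, x i ^ ((if i = k then 1 else 0) + (if i = l then 1 else 0)) = x k * x l := by
  simp only [pow_add, Finset.prod_mul_distrib, pow_ite, pow_one, pow_zero,
    Finset.prod_ite_eq', Finset.mem_univ, if_true]

lemma integrable_mul_standard_gaussian (k l : ι) :
    Integrable fun x : ι → ℝ => x k * x l * Real.exp (-(1/4 : ℝ) * (x ⬝ᵥ x)) := by
  have h := Integrable.fintype_prod (ι := ι) (μ := fun _ => (volume : Measure ℝ))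
    (fun i => integrable_pow_mul_exp_neg_quarter_sq
      ((if i = k then 1 else 0) + (if i = l then 1 else 0)))
  simp_rw [prod_pow_mul_exp_neg_quarter_sq
    (fun i => (if i = k then 1 else 0) + (if i = l then 1 else 0)), prod_pow_indicator_add] at h
  exact h

lemma integral_mul_standard_gaussian (k l : ι) :
    ∫ x : ι → ℝ, x k * x l * Real.exp (-(1/4 : ℝ) * (x ⬝ᵥ x))
      = if k = l then 2 * √(4 * Real.pi) ^ Fintype.card ι else 0 := by
  have h := integral_fintype_prod_volume_eq_prod (ι := ι)
    (fun i (x : ℝ) => x ^ ((if i = k then 1 else 0) + (if i = l then 1 else 0))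
      * Real.exp (-(1/4 : ℝ) * x ^ 2))
  simp_rw [prod_pow_mul_exp_neg_quarter_sq
    (fun i => (if i = k then 1 else 0) + (if i = l then 1 else 0)), prod_pow_indicator_add] at h
  rw [h]
  split_ifs with hkl
  · subst hkl
    have hi : ∀ i, ∫ x : ℝ, x ^ ((if i = k then 1 else 0) + (if i = k then 1 else 0))
        * Real.exp (-(1/4 : ℝ) * x ^ 2) = (if i = k then 2 else 1) * √(4 * Real.pi) := by
      intro i
      split_ifs
      · exact integral_sq_mul_exp_neg_quarter_sq
      · simpa using integral_exp_neg_quarter_sq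
    simp_rw [hi, Finset.prod_mul_distrib]
    simp
  · refine Finset.prod_eq_zero (Finset.mem_univ k) ?_
    simpa [hkl] using integral_mul_exp_neg_quarter_sq

end StandardGaussian

section LinearChange

variable {ι : Type*} [Fintype ι] [DecidableEq ι] {E : Type*} [NormedAddCommGroup E]

lemma integral_comp_mulVec [NormedSpace ℝ E] {B : Matrix ι ι ℝ} (hB : B.det ≠ 0)
    {g : (ι → ℝ) → E} (hg : Continuous g) :
    ∫ x, g (B *ᵥ x) = |B.det|⁻¹ • ∫ x, g x := by
  have hm : Measurable (toLin' B) := (toLin' B).continuous_of_finiteDimensional.measurable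
  have h := integral_map (μ := volume) hm.aemeasurable (f := g)
    hg.aestronglyMeasurable
  rw [Real.map_matrix_volume_pi_eq_smul_volume_pi hB, integral_smul_measure,
    ENNReal.toReal_ofReal (abs_nonneg _), abs_inv] at h
  exact h.symm

lemma integrable_comp_mulVec {B : Matrix ι ι ℝ} (hB : B.det ≠ 0)
    {g : (ι → ℝ) → E} (hg : Integrable g) :
    Integrable fun x => g (B *ᵥ x) := by
  have hm : Measurable (toLin' B) := (toLin' B).continuous_of_finiteDimensional.measurable
  refine Integrable.comp_measurable (g := g) (f := toLin' B) ?_ hm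
  rw [Real.map_matrix_volume_pi_eq_smul_volume_pi hB]
  exact hg.smul_measure ENNReal.ofReal_ne_top

end LinearChange

section Gaussian

variable {ι : Type*} [Fintype ι]

lemma dotProduct_transpose_mul_self_mulVec (B : Matrix ι ι ℝ) (x : ι → ℝ) :
    x ⬝ᵥ (Bᵀ * B) *ᵥ x = B *ᵥ x ⬝ᵥ B *ᵥ x := by
  rw [← mulVec_mulVec, dotProduct_mulVec, vecMul_transpose]

lemma mulVec_mul_mulVec_mul_exp (A : Matrix ι ι ℝ) (i j : ι) (x : ι → ℝ) :
    (A *ᵥ x) i * (A *ᵥ x) j * Real.exp (-(1/4 : ℝ) * (x ⬝ᵥ x))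
      = ∑ k, ∑ l, A i k * A j l * (x k * x l * Real.exp (-(1/4 : ℝ) * (x ⬝ᵥ x))) := by
  simp only [mulVec, dotProduct, Finset.sum_mul_sum]
  rw [Finset.sum_mul]
  refine Finset.sum_congr rfl fun k _ => ?_
  rw [Finset.sum_mul]
  exact Finset.sum_congr rfl fun l _ => by ring

variable [DecidableEq ι]

lemma Matrix.PosDef.exists_eq_transpose_mul_self {β : Matrix ι ι ℝ} (hβ : β.PosDef) :
    ∃ B : Matrix ι ι ℝ, B.det ≠ 0 ∧ β = Bᵀ * B ∧ √β.det = |B.det| := by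
  open scoped MatrixOrder in
  obtain ⟨B, hB⟩ := CStarAlgebra.nonneg_iff_eq_star_mul_self.mp hβ.posSemidef.nonneg
  have hB' : β = Bᵀ * B := by
    rw [hB, star_eq_conjTranspose, conjTranspose_eq_transpose_of_trivial]
  have hdet : β.det = B.det ^ 2 := by rw [hB', det_mul, det_transpose, sq]
  refine ⟨B, fun h0 => hβ.det_pos.ne' (by rw [hdet, h0]; simp), hB', ?_⟩
  rw [hdet, Real.sqrt_sq_eq_abs]

lemma integrable_gaussian {β : Matrix ι ι ℝ} (hβ : β.PosDef) :
    Integrable fun x : ι → ℝ => Real.exp (-(1/4 : ℝ) * (x ⬝ᵥ β *ᵥ x)) := by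
  obtain ⟨B, hB, rfl, -⟩ := hβ.exists_eq_transpose_mul_self
  simp_rw [dotProduct_transpose_mul_self_mulVec]
  exact integrable_comp_mulVec hB integrable_standard_gaussian

lemma sqrt_det_mul_integral_gaussian {β : Matrix ι ι ℝ} (hβ : β.PosDef) :
    √β.det * ∫ x : ι → ℝ, Real.exp (-(1/4 : ℝ) * (x ⬝ᵥ β *ᵥ x))
      = √(4 * Real.pi) ^ Fintype.card ι := by
  obtain ⟨B, hB, hβB, hs⟩ := hβ.exists_eq_transpose_mul_self
  rw [hs, hβB]
  simp_rw [dotProduct_transpose_mul_self_mulVec]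
  rw [integral_comp_mulVec hB (g := fun x => Real.exp (-(1/4 : ℝ) * (x ⬝ᵥ x)))
    (by fun_prop), integral_standard_gaussian, smul_eq_mul, mul_inv_cancel_left₀ (abs_ne_zero.2 hB)]

lemma integrable_mulVec_mul_mulVec_standard_gaussian (A : Matrix ι ι ℝ) (i j : ι) :
    Integrable fun x : ι → ℝ =>
      (A *ᵥ x) i * (A *ᵥ x) j * Real.exp (-(1/4 : ℝ) * (x ⬝ᵥ x)) := by
  simp_rw [mulVec_mul_mulVec_mul_exp]
  exact integrable_finsetSum _ fun k _ => integrable_finsetSum _ fun l _ =>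
    (integrable_mul_standard_gaussian k l).const_mul _

lemma integral_mulVec_mul_mulVec_standard_gaussian (A : Matrix ι ι ℝ) (i j : ι) :
    ∫ x : ι → ℝ, (A *ᵥ x) i * (A *ᵥ x) j * Real.exp (-(1/4 : ℝ) * (x ⬝ᵥ x))
      = 2 * (A * Aᵀ) i j * √(4 * Real.pi) ^ Fintype.card ι := by
  simp_rw [mulVec_mul_mulVec_mul_exp]
  rw [integral_finsetSum _ fun k _ => integrable_finsetSum _ fun l _ =>
    (integrable_mul_standard_gaussian k l).const_mul _]
  simp_rw [integral_finsetSum _ fun l _ => (integrable_mul_standard_gaussian _ l).const_mul _,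
    integral_const_mul, integral_mul_standard_gaussian]
  simp only [mul_ite, mul_zero, Finset.sum_ite_eq, Finset.mem_univ, if_true, mul_apply,
    transpose_apply, Finset.mul_sum, Finset.sum_mul]
  exact Finset.sum_congr rfl fun k _ => by ring

lemma mul_exp_gaussian_eq_comp {B : Matrix ι ι ℝ} (hB : B.det ≠ 0) (i j : ι) (x : ι → ℝ) :
    x i * x j * Real.exp (-(1/4 : ℝ) * (x ⬝ᵥ (Bᵀ * B) *ᵥ x))
      = (fun y : ι → ℝ => (B⁻¹ *ᵥ y) i * (B⁻¹ *ᵥ y) j * Real.exp (-(1/4 : ℝ) * (y ⬝ᵥ y)))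
        (B *ᵥ x) := by
  simp only [mulVec_mulVec, nonsing_inv_mul B (isUnit_iff_ne_zero.2 hB), one_mulVec,
    ← dotProduct_transpose_mul_self_mulVec]

lemma integrable_mul_gaussian {β : Matrix ι ι ℝ} (hβ : β.PosDef) (i j : ι) :
    Integrable fun x : ι → ℝ => x i * x j * Real.exp (-(1/4 : ℝ) * (x ⬝ᵥ β *ᵥ x)) := by
  obtain ⟨B, hB, rfl, -⟩ := hβ.exists_eq_transpose_mul_self
  simp_rw [mul_exp_gaussian_eq_comp hB]
  exact integrable_comp_mulVec hB (integrable_mulVec_mul_mulVec_standard_gaussian _ i j)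

lemma sqrt_det_mul_integral_mul_gaussian {β : Matrix ι ι ℝ} (hβ : β.PosDef) (i j : ι) :
    √β.det * ∫ x : ι → ℝ, x i * x j * Real.exp (-(1/4 : ℝ) * (x ⬝ᵥ β *ᵥ x))
      = 2 * β⁻¹ i j * √(4 * Real.pi) ^ Fintype.card ι := by
  obtain ⟨B, hB, hβB, hs⟩ := hβ.exists_eq_transpose_mul_self
  rw [hs, hβB]
  simp_rw [mul_exp_gaussian_eq_comp hB]
  rw [integral_comp_mulVec hB (g := fun y : ι → ℝ =>
      (B⁻¹ *ᵥ y) i * (B⁻¹ *ᵥ y) j * Real.exp (-(1/4 : ℝ) * (y ⬝ᵥ y))) (by fun_prop),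
    integral_mulVec_mul_mulVec_standard_gaussian,
    smul_eq_mul, mul_inv_cancel_left₀ (abs_ne_zero.2 hB), Matrix.mul_inv_rev, transpose_nonsing_inv]

/-- The Gaussian average of a constant plus a quadratic form. -/
lemma sqrt_det_mul_integral_quadratic_gaussian {β : Matrix ι ι ℝ} (hβ : β.PosDef) (a : ℝ)
    (c : ι → ι → ℝ) :
    √β.det * ∫ x : ι → ℝ, (a + ∑ i, ∑ j, x i * x j * c i j)
        * Real.exp (-(1/4 : ℝ) * (x ⬝ᵥ β *ᵥ x))
      = (a + 2 * ∑ i, ∑ j, β⁻¹ i j * c i j) * √(4 * Real.pi) ^ Fintype.card ι := by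
  have hsplit : ∀ x : ι → ℝ, (a + ∑ i, ∑ j, x i * x j * c i j)
        * Real.exp (-(1/4 : ℝ) * (x ⬝ᵥ β *ᵥ x))
      = a * Real.exp (-(1/4 : ℝ) * (x ⬝ᵥ β *ᵥ x))
        + ∑ i, ∑ j, c i j * (x i * x j * Real.exp (-(1/4 : ℝ) * (x ⬝ᵥ β *ᵥ x))) := by
    intro x
    simp only [add_mul, Finset.sum_mul]
    congr 1
    exact Finset.sum_congr rfl fun i _ => Finset.sum_congr rfl fun j _ => by ring
  have hint : ∀ i j, Integrable fun x : ι → ℝ =>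
      c i j * (x i * x j * Real.exp (-(1/4 : ℝ) * (x ⬝ᵥ β *ᵥ x))) :=
    fun i j => (integrable_mul_gaussian hβ i j).const_mul _
  simp_rw [hsplit]
  rw [integral_add ((integrable_gaussian hβ).const_mul a)
    (integrable_finsetSum _ fun i _ => integrable_finsetSum _ fun j _ => hint i j),
    integral_finsetSum _ fun i _ => integrable_finsetSum _ fun j _ => hint i j]
  simp_rw [integral_finsetSum _ fun j _ => hint _ j, integral_const_mul]
  simp only [mul_add, add_mul, Finset.mul_sum, Finset.sum_mul]
  congr 1
  · rw [← sqrt_det_mul_integral_gaussian hβ]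
    ring
  · refine Finset.sum_congr rfl fun i _ => Finset.sum_congr rfl fun j _ => ?_
    rw [mul_left_comm, sqrt_det_mul_integral_mul_gaussian hβ]
    ring

end Gaussian

lemma sum_smul_mul_sum_smul {ι A : Type*} [Fintype ι] [Ring A] [Algebra ℝ A]
    (x : ι → ℝ) (M : ι → A) :
    (∑ i, x i • M i) * (∑ i, x i • M i) = ∑ i, ∑ j, (x i * x j) • (M i * M j) := by
  simp only [Finset.sum_mul_sum, smul_mul_smul_comm]

/-- The first heat kernel coefficient on a homogeneous bundle over a symmetric space:
the Gaussian average
`⟨[R/8 + R_H/6 + (1/48) tr F(ω)² − (1/48) tr D(ω)²]·Id − 𝓡² + (1/2) 𝓡(ω)²⟩`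
equals `(R/6)·Id` (stated entrywise). -/
theorem first_heat_kernel_coefficient
    (n p d : ℕ) (hn : 0 < n) (hp : 0 < p) (hd : 0 < d)
    (β : Matrix (Fin p) (Fin p) ℝ) (hβsym : βᵀ = β) (hβpos : β.PosDef)
    (D : Fin p → Matrix (Fin n) (Fin n) ℝ)
    (F : Fin p → Matrix (Fin p) (Fin p) ℝ)
    (Rc : Fin p → Matrix (Fin d) (Fin d) ℝ)
    (R RH : ℝ)
    (hR : R = -∑ i, ∑ k, β⁻¹ i k * (D i * D k).trace)
    (hRH : RH = -(1/4 : ℝ) * ∑ i, ∑ k, β⁻¹ i k * (F i * F k).trace)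
    (R2 : Matrix (Fin d) (Fin d) ℝ)
    (hR2 : R2 = ∑ i, ∑ j, β⁻¹ i j • (Rc i * Rc j))
    (Dm : (Fin p → ℝ) → Matrix (Fin n) (Fin n) ℝ)
    (hDm : ∀ ω, Dm ω = ∑ i, ω i • D i)
    (Fm : (Fin p → ℝ) → Matrix (Fin p) (Fin p) ℝ)
    (hFm : ∀ ω, Fm ω = ∑ i, ω i • F i)
    (Rm : (Fin p → ℝ) → Matrix (Fin d) (Fin d) ℝ)
    (hRm : ∀ ω, Rm ω = ∑ i, ω i • Rc i) :
    ∀ a b : Fin d,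
      (4 * Real.pi) ^ (-(p:ℝ)/2) * Real.sqrt β.det *
        ∫ ω : Fin p → ℝ,
          (((R/8 + RH/6 + (1/48 : ℝ) * (Fm ω * Fm ω).trace
              - (1/48 : ℝ) * (Dm ω * Dm ω).trace) • (1 : Matrix (Fin d) (Fin d) ℝ)
            - R2 + (1/2 : ℝ) • (Rm ω * Rm ω)) a b)
          * Real.exp (-(1/4 : ℝ) * (ω ⬝ᵥ β.mulVec ω))
      = (R/6) * (1 : Matrix (Fin d) (Fin d) ℝ) a b := by
  intro a b
  have hdecomp : ∀ ω : Fin p → ℝ,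
      ((R/8 + RH/6 + (1/48 : ℝ) * (Fm ω * Fm ω).trace
          - (1/48 : ℝ) * (Dm ω * Dm ω).trace) • (1 : Matrix (Fin d) (Fin d) ℝ)
        - R2 + (1/2 : ℝ) • (Rm ω * Rm ω)) a b
      = ((R/8 + RH/6) * (1 : Matrix (Fin d) (Fin d) ℝ) a b - R2 a b)
        + ∑ i, ∑ j, ω i * ω j * (((1/48 : ℝ) * (F i * F j).trace
          - (1/48 : ℝ) * (D i * D j).trace) * (1 : Matrix (Fin d) (Fin d) ℝ) a b
          + (1/2 : ℝ) * (Rc i * Rc j) a b) := by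
    intro ω
    rw [hFm, hDm, hRm, sum_smul_mul_sum_smul, sum_smul_mul_sum_smul, sum_smul_mul_sum_smul]
    simp only [trace_sum, trace_smul, Matrix.add_apply, Matrix.sub_apply, Matrix.smul_apply,
      Matrix.sum_apply, smul_eq_mul]
    simp only [mul_add, mul_sub, add_mul, sub_mul, Finset.sum_add_distrib,
      Finset.sum_sub_distrib, Finset.mul_sum, Finset.sum_mul]
    simp only [mul_left_comm, mul_assoc]
    ring
  have hnorm : (4 * Real.pi) ^ (-(p:ℝ)/2) * √(4 * Real.pi) ^ p = 1 := by
    rw [Real.sqrt_eq_rpow, ← Real.rpow_natCast, ← Real.rpow_mul (by positivity),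
      ← Real.rpow_add (by positivity)]
    ring_nf
    simp
  simp_rw [hdecomp]
  rw [mul_assoc, sqrt_det_mul_integral_quadratic_gaussian hβpos, Fintype.card_fin, mul_left_comm,
    hnorm, mul_one, hR2]
  have hF : ∑ i, ∑ j, β⁻¹ i j * (F i * F j).trace = -4 * RH := by rw [hRH]; ring
  have hD : ∑ i, ∑ j, β⁻¹ i j * (D i * D j).trace = -R := by rw [hR]; ring
  have hsum : ∑ i, ∑ j, β⁻¹ i j * (((1/48 : ℝ) * (F i * F j).trace
          - (1/48 : ℝ) * (D i * D j).trace) * (1 : Matrix (Fin d) (Fin d) ℝ) a b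
          + (1/2 : ℝ) * (Rc i * Rc j) a b)
      = ((1/48 : ℝ) * ∑ i, ∑ j, β⁻¹ i j * (F i * F j).trace
          - (1/48 : ℝ) * ∑ i, ∑ j, β⁻¹ i j * (D i * D j).trace)
            * (1 : Matrix (Fin d) (Fin d) ℝ) a b
        + (1/2 : ℝ) * ∑ i, ∑ j, β⁻¹ i j * (Rc i * Rc j) a b := by
    simp only [Finset.mul_sum, Finset.sum_mul, ← Finset.sum_add_distrib,
      ← Finset.sum_sub_distrib]
    exact Finset.sum_congr rfl fun i _ => Finset.sum_congr rfl fun j _ => by ring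
  rw [hsum, hF, hD]
  simp only [Matrix.sum_apply, Matrix.smul_apply, smul_eq_mul]
  ring
end

section
/- Let r > 0 and α ∈ ℂ, and let U := {(ρ, φ) ∈ ℝ² : 0 < ρ < πr}. Define first-order differential operators on smooth complex-valued functions f on U by: L₁f = cos φ·∂_ρ f − (sin φ/r)·cot(ρ/r)·∂_φ f + i·(sin φ/(r·sin(ρ/r)))·α·f; L₂f = sin φ·∂_ρ f + (cos φ/r)·cot(ρ/r)·∂_φ f − i·(cos φ/(r·sin(ρ/r)))·α·f; L₃f = (1/r²)·∂_φ f. Then these operators form a representation of the Lie algebra of SO(3): for every smooth f on U, [L₁, L₂]f = −L₃f, [L₃, L₁]f = −(1/r²)·L₂f, and [L₃, L₂]f = (1/r²)·L₁f. -/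
open Matrix BigOperators

/-- The twisted Lie derivative `L₁` on the two-sphere of radius `r` in polar normal
coordinates `(ρ, φ)`, acting on sections of the line bundle of weight `α`. -/
noncomputable def LS1 (r : ℝ) (α : ℂ) (f : ℝ × ℝ → ℂ) : ℝ × ℝ → ℂ := fun x =>
  (Real.cos x.2 : ℂ) * fderiv ℝ f x (1, 0)
    - ((Real.sin x.2 / r * (Real.cos (x.1 / r) / Real.sin (x.1 / r)) : ℝ) : ℂ) *
        fderiv ℝ f x (0, 1)
    + Complex.I * ((Real.sin x.2 / (r * Real.sin (x.1 / r)) : ℝ) : ℂ) * α * f x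

/-- The twisted Lie derivative `L₂` on the two-sphere of radius `r`. -/
noncomputable def LS2 (r : ℝ) (α : ℂ) (f : ℝ × ℝ → ℂ) : ℝ × ℝ → ℂ := fun x =>
  (Real.sin x.2 : ℂ) * fderiv ℝ f x (1, 0)
    + ((Real.cos x.2 / r * (Real.cos (x.1 / r) / Real.sin (x.1 / r)) : ℝ) : ℂ) *
        fderiv ℝ f x (0, 1)
    - Complex.I * ((Real.cos x.2 / (r * Real.sin (x.1 / r)) : ℝ) : ℂ) * α * f x

/-- The twisted Lie derivative `L₃` on the two-sphere of radius `r`. -/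
noncomputable def LS3 (r : ℝ) (f : ℝ × ℝ → ℂ) : ℝ × ℝ → ℂ := fun x =>
  ((1 / r^2 : ℝ) : ℂ) * fderiv ℝ f x (0, 1)

/-- The first-order differential operator `a ∂₁ + b ∂₂ + c` on functions of two real variables. -/
noncomputable def firstOrderOp (a b c f : ℝ × ℝ → ℂ) : ℝ × ℝ → ℂ := fun x =>
  a x * fderiv ℝ f x (1, 0) + b x * fderiv ℝ f x (0, 1) + c x * f x

theorem fderiv_firstOrderOp_apply {a b c f : ℝ × ℝ → ℂ} {a' b' c' : ℝ × ℝ →L[ℝ] ℂ}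
    {x : ℝ × ℝ} (hf : ContDiff ℝ 2 f) (ha : HasFDerivAt a a' x) (hb : HasFDerivAt b b' x)
    (hc : HasFDerivAt c c' x) (v : ℝ × ℝ) :
    fderiv ℝ (firstOrderOp a b c f) x v =
      a' v * fderiv ℝ f x (1, 0) + a x * fderiv ℝ (fderiv ℝ f) x v (1, 0)
      + (b' v * fderiv ℝ f x (0, 1) + b x * fderiv ℝ (fderiv ℝ f) x v (0, 1))
      + (c' v * f x + c x * fderiv ℝ f x v) := by
  have hf₁ : HasFDerivAt f (fderiv ℝ f x) x := (hf.differentiable (by norm_num) x).hasFDerivAt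
  have hf₂ : HasFDerivAt (fderiv ℝ f) (fderiv ℝ (fderiv ℝ f) x) x :=
    ((hf.fderiv_right (m := 1) (by norm_num)).differentiable (by norm_num) x).hasFDerivAt
  have h := ((ha.mul (hf₂.clm_apply (hasFDerivAt_const ((1 : ℝ), (0 : ℝ)) x))).add
    (hb.mul (hf₂.clm_apply (hasFDerivAt_const ((0 : ℝ), (1 : ℝ)) x)))).add (hc.mul hf₁)
  have h' : HasFDerivAt (firstOrderOp a b c f) _ x := h
  rw [h'.fderiv]
  simp
  ring

/-- The commutator of two first-order operators is again a first-order operator. -/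
theorem firstOrderOp_commutator {a₁ b₁ c₁ a₂ b₂ c₂ f : ℝ × ℝ → ℂ}
    {a₁' b₁' c₁' a₂' b₂' c₂' : ℝ × ℝ →L[ℝ] ℂ} {x : ℝ × ℝ} (hf : ContDiff ℝ 2 f)
    (ha₁ : HasFDerivAt a₁ a₁' x) (hb₁ : HasFDerivAt b₁ b₁' x) (hc₁ : HasFDerivAt c₁ c₁' x)
    (ha₂ : HasFDerivAt a₂ a₂' x) (hb₂ : HasFDerivAt b₂ b₂' x) (hc₂ : HasFDerivAt c₂ c₂' x) :
    firstOrderOp a₁ b₁ c₁ (firstOrderOp a₂ b₂ c₂ f) x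
        - firstOrderOp a₂ b₂ c₂ (firstOrderOp a₁ b₁ c₁ f) x =
      (a₁ x * a₂' (1, 0) + b₁ x * a₂' (0, 1) - a₂ x * a₁' (1, 0) - b₂ x * a₁' (0, 1))
          * fderiv ℝ f x (1, 0)
      + (a₁ x * b₂' (1, 0) + b₁ x * b₂' (0, 1) - a₂ x * b₁' (1, 0) - b₂ x * b₁' (0, 1))
          * fderiv ℝ f x (0, 1)
      + (a₁ x * c₂' (1, 0) + b₁ x * c₂' (0, 1) - a₂ x * c₁' (1, 0) - b₂ x * c₁' (0, 1))
          * f x := by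
  have hsymm : fderiv ℝ (fderiv ℝ f) x (1, 0) (0, 1) = fderiv ℝ (fderiv ℝ f) x (0, 1) (1, 0) :=
    (hf.contDiffAt.isSymmSndFDerivAt (by simp)) (1, 0) (0, 1)
  rw [firstOrderOp.eq_def a₁ b₁ c₁ (firstOrderOp a₂ b₂ c₂ f),
    firstOrderOp.eq_def a₂ b₂ c₂ (firstOrderOp a₁ b₁ c₁ f)]
  simp only [fderiv_firstOrderOp_apply hf ha₁ hb₁ hc₁, fderiv_firstOrderOp_apply hf ha₂ hb₂ hc₂]
  simp only [firstOrderOp, hsymm]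
  ring

/-- The derivative of a complex multiple of a product `u(φ) w(ρ)` of real functions. -/
theorem hasFDerivAt_const_mul_ofReal_mul {u w : ℝ → ℝ} {u' w' : ℝ} {x : ℝ × ℝ} (z : ℂ)
    (hu : HasDerivAt u u' x.2) (hw : HasDerivAt w w' x.1) :
    HasFDerivAt (fun y : ℝ × ℝ => z * (u y.2 * w y.1 : ℂ))
      ((z * (u x.2 * w' : ℂ)) • Complex.ofRealCLM.comp (ContinuousLinearMap.fst ℝ ℝ ℝ)
        + (z * (u' * w x.1 : ℂ)) • Complex.ofRealCLM.comp (ContinuousLinearMap.snd ℝ ℝ ℝ)) x := by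
  have hu₂ : HasFDerivAt (fun y : ℝ × ℝ => u y.2) _ x :=
    hu.hasFDerivAt.comp x (hasFDerivAt_snd (p := x))
  have hw₁ : HasFDerivAt (fun y : ℝ × ℝ => w y.1) _ x :=
    hw.hasFDerivAt.comp x (hasFDerivAt_fst (p := x))
  have h := ((Complex.ofRealCLM.hasFDerivAt.comp x hu₂).mul
    (Complex.ofRealCLM.hasFDerivAt.comp x hw₁)).const_mul z
  refine h.congr_fderiv ?_
  ext <;> simp [mul_comm]

theorem LS1_eq_firstOrderOp (r : ℝ) (α : ℂ) : LS1 r α = firstOrderOp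
    (fun y => 1 * (Real.cos y.2 * (1 : ℝ)))
    (fun y => -(r : ℂ)⁻¹ * (Real.sin y.2 * (Real.cos (y.1 / r) / Real.sin (y.1 / r) : ℝ)))
    (fun y => (Complex.I * α * (r : ℂ)⁻¹) * (Real.sin y.2 * ((Real.sin (y.1 / r))⁻¹ : ℝ))) := by
  ext f y
  simp only [LS1, firstOrderOp, Complex.ofReal_mul, Complex.ofReal_inv,
    Complex.ofReal_one, div_eq_mul_inv, mul_inv]
  ring

theorem LS2_eq_firstOrderOp (r : ℝ) (α : ℂ) : LS2 r α = firstOrderOp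
    (fun y => 1 * (Real.sin y.2 * (1 : ℝ)))
    (fun y => (r : ℂ)⁻¹ * (Real.cos y.2 * (Real.cos (y.1 / r) / Real.sin (y.1 / r) : ℝ)))
    (fun y => (-Complex.I * α * (r : ℂ)⁻¹) * (Real.cos y.2 * ((Real.sin (y.1 / r))⁻¹ : ℝ))) := by
  ext f y
  simp only [LS2, firstOrderOp, Complex.ofReal_mul, Complex.ofReal_inv,
    Complex.ofReal_one, div_eq_mul_inv, mul_inv]
  ring

theorem LS3_eq_firstOrderOp (r : ℝ) : LS3 r = firstOrderOp
    (fun _ => 0) (fun _ => ((1 / r ^ 2 : ℝ) : ℂ)) (fun _ => 0) := by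
  ext f y
  simp [LS3, firstOrderOp]

/-- The twisted Lie derivatives on `S² = SO(3)/SO(2)` form a representation of the Lie
algebra of `SO(3)`: `[L₁,L₂] = −L₃`, `[L₃,L₁] = −(1/r²)L₂`, `[L₃,L₂] = (1/r²)L₁`. -/
theorem sphere_lie_algebra_representation
    (r : ℝ) (hr : 0 < r) (α : ℂ)
    (f : ℝ × ℝ → ℂ) (hf : ContDiff ℝ (⊤ : ℕ∞) f) :
    ∀ x : ℝ × ℝ, 0 < x.1 → x.1 < Real.pi * r →
      (LS1 r α (LS2 r α f) x - LS2 r α (LS1 r α f) x = -(LS3 r f x)) ∧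
      (LS3 r (LS1 r α f) x - LS1 r α (LS3 r f) x = -((1 / r^2 : ℝ) : ℂ) * LS2 r α f x) ∧
      (LS3 r (LS2 r α f) x - LS2 r α (LS3 r f) x = ((1 / r^2 : ℝ) : ℂ) * LS1 r α f x) := by
  intro x hx₀ hx₁
  have hf₂ : ContDiff ℝ 2 f := contDiff_infty.1 hf 2
  have hs : Real.sin (x.1 / r) ≠ 0 :=
    (Real.sin_pos_of_pos_of_lt_pi (div_pos hx₀ hr) ((div_lt_iff₀ hr).2 hx₁)).ne'
  have hdiv : HasDerivAt (fun t : ℝ => t / r) (1 / r) x.1 := (hasDerivAt_id x.1).div_const r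
  have hsin := hdiv.sin
  have hcot := hdiv.cos.fun_div hsin hs
  have hcsc := hsin.fun_inv hs
  have hone := hasDerivAt_const x.1 (1 : ℝ)
  have hsinφ := Real.hasDerivAt_sin x.2
  have hcosφ := Real.hasDerivAt_cos x.2
  have ha₁ := hasFDerivAt_const_mul_ofReal_mul 1 hcosφ hone
  have hb₁ := hasFDerivAt_const_mul_ofReal_mul (-(r : ℂ)⁻¹) hsinφ hcot
  have hc₁ := hasFDerivAt_const_mul_ofReal_mul (Complex.I * α * (r : ℂ)⁻¹) hsinφ hcsc
  have ha₂ := hasFDerivAt_const_mul_ofReal_mul 1 hsinφ hone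
  have hb₂ := hasFDerivAt_const_mul_ofReal_mul ((r : ℂ)⁻¹) hcosφ hcot
  have hc₂ := hasFDerivAt_const_mul_ofReal_mul (-Complex.I * α * (r : ℂ)⁻¹) hcosφ hcsc
  have hzero := hasFDerivAt_const (𝕜 := ℝ) (0 : ℂ) x
  have hb₃ := hasFDerivAt_const (𝕜 := ℝ) ((1 / r ^ 2 : ℝ) : ℂ) x
  have hrC : (r : ℂ) ≠ 0 := by exact_mod_cast hr.ne'
  have hsC : (Real.sin (x.1 / r) : ℂ) ≠ 0 := by exact_mod_cast hs
  have hφ : (Real.sin x.2 : ℂ) ^ 2 + (Real.cos x.2 : ℂ) ^ 2 = 1 := by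
    exact_mod_cast Real.sin_sq_add_cos_sq x.2
  rw [LS1_eq_firstOrderOp, LS2_eq_firstOrderOp, LS3_eq_firstOrderOp,
    firstOrderOp_commutator hf₂ ha₁ hb₁ hc₁ ha₂ hb₂ hc₂,
    firstOrderOp_commutator hf₂ hzero hb₃ hzero ha₁ hb₁ hc₁,
    firstOrderOp_commutator hf₂ hzero hb₃ hzero ha₂ hb₂ hc₂]
  simp [firstOrderOp, -Complex.ofReal_sin, -Complex.ofReal_cos]
  generalize (Real.sin (x.1 / r) : ℂ) = s at *
  generalize (Real.cos (x.1 / r) : ℂ) = c at *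
  generalize (Real.sin x.2 : ℂ) = S at *
  generalize (Real.cos x.2 : ℂ) = C at *
  refine ⟨?_, ?_, ?_⟩
  · field_simp
    linear_combination (-s ^ 2 * fderiv ℝ f x (0, 1)) * hφ
  · field_simp
    ring
  · field_simp
end

section
/- Let N be a positive integer and C^A{}_{BC} real constants, antisymmetric in B, C, satisfying the Jacobi identity, and let C_A denote the N×N matrix with entries (C_A)^B{}_C = C^B{}_{AC}. For k ∈ ℝᴺ set C(k) := Σ_A k^A C_A and define the entire matrix-valued function Y(k) := Σ_{m≥0} ((−1)^m/(m+1)!)·C(k)^m (so Y(k) = (1 − exp(−C(k)))·C(k)⁻¹ as a power series), with entries Y^A{}_M(k). Then for all k ∈ ℝᴺ and all indices A, L, M, the Maurer–Cartan equation holds: ∂_L Y^A{}_M(k) − ∂_M Y^A{}_L(k) = −Σ_{B,C} C^A{}_{BC}·Y^B{}_L(k)·Y^C{}_M(k), where ∂_M denotes the partial derivative with respect to k^M. -/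
open Matrix BigOperators

section PowerSeries

variable {R : Type*} [NormedRing R] [NormedAlgebra ℝ R]

/-- The Fréchet derivative of `x ↦ x ^ n` in a (noncommutative) normed algebra. -/
noncomputable def powFDeriv : ℕ → R → (R →L[ℝ] R)
  | 0, _ => 0
  | n + 1, x => ContinuousLinearMap.mul ℝ R x ∘L powFDeriv n x +
      (ContinuousLinearMap.mul ℝ R).flip (x ^ n)

lemma powFDeriv_succ_apply (n : ℕ) (x h : R) :
    powFDeriv (n + 1) x h = x * powFDeriv n x h + h * x ^ n := rfl

lemma hasFDerivAt_pow_powFDeriv (n : ℕ) (x : R) :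
    HasFDerivAt (fun y : R => y ^ n) (powFDeriv n x) x := by
  induction n with
  | zero => simpa [powFDeriv] using hasFDerivAt_const (1 : R) x
  | succ n ih =>
    have h := (hasFDerivAt_id (𝕜 := ℝ) x).mul' ih
    simp only [pow_succ']
    refine h.congr_fderiv ?_
    ext y
    simp [powFDeriv_succ_apply]

lemma norm_powFDeriv_le [NormOneClass R] {r : ℝ} (hr : 1 ≤ r) (n : ℕ) {x : R} (hx : ‖x‖ ≤ r) :
    ‖powFDeriv n x‖ ≤ n * r ^ n := by
  have hr0 : 0 ≤ r := zero_le_one.trans hr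
  induction n with
  | zero => simp [powFDeriv]
  | succ n ih =>
    refine ContinuousLinearMap.opNorm_le_bound _ (by positivity) fun h => ?_
    have h1 : ‖x * powFDeriv n x h‖ ≤ r * ((n * r ^ n) * ‖h‖) :=
      (norm_mul_le _ _).trans <| by
        gcongr
        exact (powFDeriv n x).le_of_opNorm_le ih h
    have h2 : ‖h * x ^ n‖ ≤ ‖h‖ * r ^ n :=
      (norm_mul_le _ _).trans <| by
        gcongr
        exact (norm_pow_le x n).trans (by gcongr)
    have h3 : ‖h‖ * r ^ n ≤ ‖h‖ * (r * r ^ n) := by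
      gcongr
      exact le_mul_of_one_le_left (by positivity) hr
    rw [powFDeriv_succ_apply]
    calc _ ≤ _ := norm_add_le _ _
      _ ≤ r * ((n * r ^ n) * ‖h‖) + ‖h‖ * (r * r ^ n) := by linarith
      _ = _ := by push_cast; ring

/-- The Taylor coefficients of `(1 - exp (-x)) / x`. -/
noncomputable def expQuotCoeff (n : ℕ) : ℝ := (-1) ^ n / (n + 1).factorial

lemma expQuotCoeff_succ (n : ℕ) : ((n : ℝ) + 2) * expQuotCoeff (n + 1) = -expQuotCoeff n := by
  have h : ((n + 1).factorial : ℝ) ≠ 0 := by positivity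
  have h' : (n : ℝ) + 2 ≠ 0 := by positivity
  simp only [expQuotCoeff, Nat.factorial_succ (n + 1), pow_succ]
  push_cast
  rw [show (n : ℝ) + 1 + 1 = n + 2 by ring]
  field_simp

lemma norm_expQuotCoeff (n : ℕ) : ‖expQuotCoeff n‖ = 1 / (n + 1).factorial := by
  simp [expQuotCoeff]

lemma norm_expQuotCoeff_mul (r : ℝ) (n : ℕ) :
    ‖expQuotCoeff n‖ * (((n : ℝ) + 1) * r ^ n) = r ^ n / n.factorial := by
  rw [norm_expQuotCoeff, Nat.factorial_succ]
  have h : (n.factorial : ℝ) ≠ 0 := by positivity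
  have h' : (n : ℝ) + 1 ≠ 0 := by positivity
  push_cast
  field_simp

variable [NormOneClass R]

lemma norm_expQuotCoeff_smul_pow_le (x : R) (n : ℕ) :
    ‖expQuotCoeff n • x ^ n‖ ≤ ‖x‖ ^ n / n.factorial := by
  rw [← norm_expQuotCoeff_mul, norm_smul]
  gcongr
  refine (norm_pow_le x n).trans (le_mul_of_one_le_left (by positivity) ?_)
  simp

lemma norm_expQuotCoeff_smul_powFDeriv_le {r : ℝ} (hr : 1 ≤ r) (n : ℕ) {x : R} (hx : ‖x‖ ≤ r) :
    ‖expQuotCoeff n • powFDeriv n x‖ ≤ r ^ n / n.factorial := by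
  have hr0 : 0 ≤ r := zero_le_one.trans hr
  rw [← norm_expQuotCoeff_mul, norm_smul]
  gcongr
  refine (norm_powFDeriv_le hr n hx).trans ?_
  gcongr
  simp

variable [CompleteSpace R]

lemma summable_expQuotCoeff_smul_pow (x : R) : Summable fun n => expQuotCoeff n • x ^ n :=
  .of_norm_bounded (Real.summable_pow_div_factorial ‖x‖) (norm_expQuotCoeff_smul_pow_le x)

lemma summable_expQuotCoeff_smul_powFDeriv (x : R) :
    Summable fun n => expQuotCoeff n • powFDeriv n x :=
  .of_norm_bounded (Real.summable_pow_div_factorial (‖x‖ + 1)) fun n =>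
    norm_expQuotCoeff_smul_powFDeriv_le (by simp) n (by simp)

lemma hasFDerivAt_tsum_expQuotCoeff_smul_pow (x : R) :
    HasFDerivAt (fun y : R => ∑' n, expQuotCoeff n • y ^ n)
      (∑' n, expQuotCoeff n • powFDeriv n x) x := by
  have hx : x ∈ Metric.ball (0 : R) (‖x‖ + 1) := by simp
  exact hasFDerivAt_tsum_of_isPreconnected (Real.summable_pow_div_factorial (‖x‖ + 1))
    Metric.isOpen_ball (convex_ball (0 : R) _).isPreconnected
    (fun n y _ => (hasFDerivAt_pow_powFDeriv n y).const_smul (expQuotCoeff n))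
    (fun n y hy => norm_expQuotCoeff_smul_powFDeriv_le (by simp) n
      (mem_ball_zero_iff.mp hy).le)
    hx (summable_expQuotCoeff_smul_pow x) hx

end PowerSeries

/-- The coefficientwise Maurer–Cartan equation: `y`, `z` are the homogeneous components of the
left-invariant form evaluated on `l`, `m`, and `w` those of its exterior derivative. -/
lemma maurer_cartan_coeff {V : Type*} [AddCommGroup V] [Module ℝ V] (br : V →ₗ[ℝ] V →ₗ[ℝ] V)
    (hanti : ∀ u v, br u v = -br v u) (k : V)
    (hder : ∀ u v, br k (br u v) = br (br k u) v + br u (br k v))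
    (y z w : ℕ → V)
    (hy : ∀ n : ℕ, ((n : ℝ) + 2) • y (n + 1) = -br k (y n))
    (hz : ∀ n : ℕ, ((n : ℝ) + 2) • z (n + 1) = -br k (z n))
    (hw0 : w 0 = 0)
    (hw : ∀ n : ℕ, ((n : ℝ) + 2) • w (n + 1) =
      -(br k (w n) + br (y 0) (z n) - br (z 0) (y n))) (n : ℕ) :
    w (n + 1) = -∑ p ∈ Finset.HasAntidiagonal.antidiagonal n, br (y p.1) (z p.2) := by
  induction n with
  | zero =>
    have h := hw 0
    rw [hw0, hanti (z 0)] at h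
    have h2 : (2 : ℝ) • w 1 = (2 : ℝ) • -br (y 0) (z 0) := by
      simp only [Nat.cast_zero, zero_add, map_zero] at h
      rw [h, two_smul]
      abel
    simpa using smul_right_injective V (two_ne_zero (α := ℝ)) h2
  | succ n ih =>
    have hn : ((n + 1 : ℕ) : ℝ) + 2 ≠ 0 := by positivity
    apply smul_right_injective V hn
    have hsplit : (((n + 1 : ℕ) : ℝ) + 2) •
          ∑ p ∈ Finset.HasAntidiagonal.antidiagonal (n + 1), br (y p.1) (z p.2) =
        ∑ p ∈ Finset.HasAntidiagonal.antidiagonal (n + 1), ((p.1 : ℝ) + 1) • br (y p.1) (z p.2) +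
        ∑ p ∈ Finset.HasAntidiagonal.antidiagonal (n + 1), ((p.2 : ℝ) + 1) • br (y p.1) (z p.2) := by
      rw [Finset.smul_sum, ← Finset.sum_add_distrib]
      refine Finset.sum_congr rfl fun p hp => ?_
      rw [← add_smul, ← Finset.HasAntidiagonal.mem_antidiagonal.mp hp]
      push_cast
      congr 1
      ring
    have h1 : ∑ p ∈ Finset.HasAntidiagonal.antidiagonal (n + 1), ((p.1 : ℝ) + 1) • br (y p.1) (z p.2) =
        br (y 0) (z (n + 1)) - ∑ p ∈ Finset.HasAntidiagonal.antidiagonal n, br (br k (y p.1)) (z p.2) := by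
      rw [Finset.Nat.sum_antidiagonal_succ, sub_eq_add_neg, ← Finset.sum_neg_distrib]
      congr 1
      · simp
      · refine Finset.sum_congr rfl fun p _ => ?_
        rw [← LinearMap.neg_apply, ← map_neg, ← hy, map_smul, LinearMap.smul_apply]
        push_cast
        congr 1
        ring
    have h2 : ∑ p ∈ Finset.HasAntidiagonal.antidiagonal (n + 1), ((p.2 : ℝ) + 1) • br (y p.1) (z p.2) =
        br (y (n + 1)) (z 0) - ∑ p ∈ Finset.HasAntidiagonal.antidiagonal n, br (y p.1) (br k (z p.2)) := by
      rw [Finset.Nat.sum_antidiagonal_succ', sub_eq_add_neg, ← Finset.sum_neg_distrib]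
      congr 1
      · simp
      · refine Finset.sum_congr rfl fun p _ => ?_
        rw [← map_neg, ← hz, map_smul]
        push_cast
        congr 1
        ring
    have h3 : br k (w (n + 1)) = -(∑ p ∈ Finset.HasAntidiagonal.antidiagonal n, br (br k (y p.1)) (z p.2) +
        ∑ p ∈ Finset.HasAntidiagonal.antidiagonal n, br (y p.1) (br k (z p.2))) := by
      rw [ih, map_neg, map_sum, ← Finset.sum_add_distrib]
      simp only [hder]
    beta_reduce
    rw [smul_neg, hsplit, hw, h1, h2, h3, hanti (z 0)]
    abel

/-- The bracket on `Fin N → ℝ` with the given structure constants. -/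
noncomputable def structureBracket {N : ℕ} (c : Fin N → Fin N → Fin N → ℝ) :
    (Fin N → ℝ) →ₗ[ℝ] (Fin N → ℝ) →ₗ[ℝ] (Fin N → ℝ) :=
  LinearMap.mk₂ ℝ (fun u v A => ∑ B, ∑ C, c A B C * u B * v C)
    (fun u u' v => by
      ext A; simp [mul_add, add_mul, Finset.sum_add_distrib])
    (fun a u v => by
      ext A; simp only [Pi.smul_apply, smul_eq_mul, Finset.mul_sum]
      exact Finset.sum_congr rfl fun _ _ => Finset.sum_congr rfl fun _ _ => by ring)
    (fun u v v' => by
      ext A; simp [mul_add, Finset.sum_add_distrib])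
    (fun a u v => by
      ext A; simp only [Pi.smul_apply, smul_eq_mul, Finset.mul_sum]
      exact Finset.sum_congr rfl fun _ _ => Finset.sum_congr rfl fun _ _ => by ring)

section StructureBracket

variable {N : ℕ} (c : Fin N → Fin N → Fin N → ℝ)

lemma structureBracket_apply (u v : Fin N → ℝ) (A : Fin N) :
    structureBracket c u v A = ∑ B, ∑ C, c A B C * u B * v C := rfl

lemma structureBracket_anti (hanti : ∀ A B C, c A B C = -c A C B) (u v : Fin N → ℝ) :
    structureBracket c u v = -structureBracket c v u := by
  ext A
  simp only [Pi.neg_apply, structureBracket_apply]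
  rw [Finset.sum_comm]
  simp only [← Finset.sum_neg_distrib]
  refine Finset.sum_congr rfl fun B _ => Finset.sum_congr rfl fun C _ => ?_
  rw [hanti A C B]
  ring

lemma structureBracket_single_left (i A : Fin N) (v : Fin N → ℝ) :
    structureBracket c (Pi.single i 1) v A = ∑ C, c A i C * v C := by
  simp [structureBracket_apply, Pi.single_apply]

lemma structureBracket_leibniz (hanti : ∀ A B C, c A B C = -c A C B)
    (hJacobi : ∀ A C D E : Fin N,
      ∑ B, (c A B C * c B D E + c A B D * c B E C + c A B E * c B C D) = 0)
    (k u v : Fin N → ℝ) :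
    structureBracket c k (structureBracket c u v) =
      structureBracket c (structureBracket c k u) v +
        structureBracket c u (structureBracket c k v) := by
  set b := structureBracket c with hb
  let F : (Fin N → ℝ) →ₗ[ℝ] (Fin N → ℝ) →ₗ[ℝ] (Fin N → ℝ) →ₗ[ℝ] (Fin N → ℝ) :=
    LinearMap.mk₂ ℝ (fun k u => b k ∘ₗ b u - b (b k u) - b u ∘ₗ b k)
      (fun _ _ _ => LinearMap.ext fun _ => by simp; abel) (fun _ _ _ => LinearMap.ext fun _ => by simp [smul_sub])
      (fun _ _ _ => LinearMap.ext fun _ => by simp; abel) (fun _ _ _ => LinearMap.ext fun _ => by simp [smul_sub])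
  have hF : F = 0 := by
    refine (Pi.basisFun ℝ (Fin N)).ext fun i => (Pi.basisFun ℝ (Fin N)).ext fun j =>
      (Pi.basisFun ℝ (Fin N)).ext fun l => ?_
    ext A
    simp only [Pi.basisFun_apply, LinearMap.zero_apply, Pi.zero_apply]
    change b (Pi.single i 1) (b (Pi.single j 1) (Pi.single l 1)) A
      - b (b (Pi.single i 1) (Pi.single j 1)) (Pi.single l 1) A
      - b (Pi.single j 1) (b (Pi.single i 1) (Pi.single l 1)) A = 0
    rw [hb, structureBracket_anti c hanti (structureBracket c _ _), Pi.neg_apply]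
    simp only [structureBracket_single_left, Pi.single_apply, mul_ite, mul_one, mul_zero,
      Finset.sum_ite_eq', Finset.mem_univ, if_true]
    rw [← neg_eq_zero, ← hJacobi A i j l, sub_neg_eq_add, ← Finset.sum_add_distrib,
      ← Finset.sum_sub_distrib, ← Finset.sum_neg_distrib]
    refine Finset.sum_congr rfl fun B _ => ?_
    rw [hanti A B i, hanti A B j, hanti A B l, hanti B l i]
    ring
  have h := congrArg (fun G => G k u v) hF
  change b k (b u v) - b (b k u) v - b u (b k v) = 0 at h
  rw [sub_sub, sub_eq_zero] at h
  exact h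

/-- Cauchy product formula for the structure bracket of two absolutely convergent series. -/
lemma hasSum_structureBracket_antidiagonal {f g : ℕ → Fin N → ℝ} {u v : Fin N → ℝ}
    (hf : ∀ B, HasSum (fun n => f n B) (u B)) (hg : ∀ B, HasSum (fun n => g n B) (v B))
    (A : Fin N) :
    HasSum (fun n => ∑ p ∈ Finset.HasAntidiagonal.antidiagonal n,
      structureBracket c (f p.1) (g p.2) A) (structureBracket c u v A) := by
  have hprod (B C : Fin N) : HasSum (fun n => ∑ p ∈ Finset.HasAntidiagonal.antidiagonal n,
      f p.1 B * g p.2 C) (u B * v C) := by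
    have hfB := (hf B).summable.norm
    have hgC := (hg C).summable.norm
    rw [← (hf B).tsum_eq, ← (hg C).tsum_eq,
      tsum_mul_tsum_eq_tsum_sum_antidiagonal_of_summable_norm hfB hgC]
    exact (summable_norm_sum_mul_antidiagonal_of_summable_norm hfB hgC).of_norm.hasSum
  have h := hasSum_sum (s := Finset.univ) fun B _ =>
    hasSum_sum (s := Finset.univ) fun C _ => (hprod B C).mul_left (c A B C)
  simp only [structureBracket_apply, mul_assoc]
  refine (congrArg (HasSum · _) (funext fun n => ?_)).mpr h
  rw [Finset.sum_comm (s := Finset.HasAntidiagonal.antidiagonal n)]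
  refine Finset.sum_congr rfl fun B _ => ?_
  rw [Finset.sum_comm]
  exact Finset.sum_congr rfl fun C _ => (Finset.mul_sum _ _ _).symm

end StructureBracket

/-- The Maurer–Cartan equation in canonical coordinates on a Lie group:
for `Y(k) = (1 - exp(-C(k)))/C(k)` one has
`∂_L Y^A_M − ∂_M Y^A_L = −C^A_{BC} Y^B_L Y^C_M`. -/
theorem maurer_cartan
    (N : ℕ) (hN : 0 < N)
    (Cc : Fin N → Fin N → Fin N → ℝ)
    (hanti : ∀ A B C, Cc A B C = -Cc A C B)
    (hJacobi : ∀ A C D E : Fin N,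
      ∑ B, (Cc A B C * Cc B D E + Cc A B D * Cc B E C + Cc A B E * Cc B C D) = 0)
    (CM : Fin N → Matrix (Fin N) (Fin N) ℝ)
    (hCM : ∀ A B C, CM A B C = Cc B A C)
    (Ck : (Fin N → ℝ) → Matrix (Fin N) (Fin N) ℝ)
    (hCk : ∀ k, Ck k = ∑ A, k A • CM A)
    (Y : (Fin N → ℝ) → Matrix (Fin N) (Fin N) ℝ)
    (hY : ∀ k, Y k = ∑' m : ℕ, (((-1:ℝ)^m / (Nat.factorial (m+1))) • (Ck k)^m)) :
    ∀ (k : Fin N → ℝ) (A L M : Fin N),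
      fderiv ℝ (fun k' => Y k' A M) k (Pi.single L 1)
        - fderiv ℝ (fun k' => Y k' A L) k (Pi.single M 1)
      = -∑ B, ∑ C, Cc A B C * Y k B L * Y k C M := by
  intro k A L M
  have : Nonempty (Fin N) := ⟨⟨0, hN⟩⟩
  let : NormedRing (Matrix (Fin N) (Fin N) ℝ) := Matrix.linftyOpNormedRing
  let : NormedAlgebra ℝ (Matrix (Fin N) (Fin N) ℝ) := Matrix.linftyOpNormedAlgebra
  have : NormOneClass (Matrix (Fin N) (Fin N) ℝ) := Matrix.linfty_opNormOneClass
  have : CompleteSpace (Matrix (Fin N) (Fin N) ℝ) := FiniteDimensional.complete ℝ _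
  have hCk_mulVec (u v : Fin N → ℝ) : Ck u *ᵥ v = structureBracket Cc u v := by
    ext B
    simp only [hCk, structureBracket_apply, Matrix.mulVec, dotProduct, Matrix.sum_apply,
      Matrix.smul_apply, hCM, smul_eq_mul, Finset.sum_mul]
    rw [Finset.sum_comm]
    exact Finset.sum_congr rfl fun _ _ => Finset.sum_congr rfl fun _ _ => by ring
  have hCk_single (i : Fin N) : Ck (Pi.single i 1) = CM i := by
    simp [hCk, Pi.single_apply]
  let T : (Fin N → ℝ) →L[ℝ] Matrix (Fin N) (Fin N) ℝ :=
    LinearMap.toContinuousLinearMap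
      { toFun := Ck
        map_add' := fun u v => by simp [hCk, add_smul, Finset.sum_add_distrib]
        map_smul' := fun a u => by simp [hCk, mul_smul, Finset.smul_sum] }
  have hT (u) : T u = Ck u := rfl
  let e (i j : Fin N) : Matrix (Fin N) (Fin N) ℝ →L[ℝ] ℝ :=
    LinearMap.toContinuousLinearMap (Matrix.entryLinearMap ℝ ℝ i j)
  have hYsum (i j : Fin N) :
      HasSum (fun n => (expQuotCoeff n • Ck k ^ n) i j) (Y k i j) := by
    have h := (summable_expQuotCoeff_smul_pow (Ck k)).hasSum.mapL (e i j)
    rw [hY]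
    exact h
  have hfderiv (i l : Fin N) (j : Fin N) :
      HasSum (fun n => (expQuotCoeff n • powFDeriv n (Ck k) (CM l)) i j)
        (fderiv ℝ (fun k' => Y k' i j) k (Pi.single l 1)) := by
    have h1 : HasFDerivAt (fun k' => Y k' i j)
        ((e i j ∘L (∑' n, expQuotCoeff n • powFDeriv n (Ck k))) ∘L T) k := by
      have h := ((e i j).hasFDerivAt.comp (T k)
        (hasFDerivAt_tsum_expQuotCoeff_smul_pow (T k))).comp k T.hasFDerivAt
      refine h.congr_of_eventuallyEq (Filter.Eventually.of_forall fun k' => ?_)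
      simp only [hY]
      rfl
    rw [h1.fderiv]
    have h2 := ((summable_expQuotCoeff_smul_powFDeriv (Ck k)).hasSum.mapL
      (ContinuousLinearMap.apply ℝ (Matrix (Fin N) (Fin N) ℝ) (CM l))).mapL (e i j)
    rw [← hCk_single l] at h2 ⊢
    exact h2
  have hcol (X Z : Matrix (Fin N) (Fin N) ℝ) (j : Fin N) : (X * Z).col j = X *ᵥ Z.col j := by
    ext i
    rfl
  have hpow (j : Fin N) (n : ℕ) :
      ((n : ℝ) + 2) • (expQuotCoeff (n + 1) • Ck k ^ (n + 1)).col j =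
        -structureBracket Cc k ((expQuotCoeff n • Ck k ^ n).col j) := by
    rw [← hCk_mulVec, ← hcol, mul_smul_comm, ← pow_succ']
    ext i
    simp only [Matrix.col_apply, Matrix.smul_apply, Pi.smul_apply, Pi.neg_apply, smul_eq_mul]
    rw [← mul_assoc, expQuotCoeff_succ]
    ring
  have hcoeff := maurer_cartan_coeff (structureBracket Cc) (structureBracket_anti Cc hanti) k
    (structureBracket_leibniz Cc hanti hJacobi k)
    (fun n => (expQuotCoeff n • Ck k ^ n).col L) (fun n => (expQuotCoeff n • Ck k ^ n).col M)
    (fun n => (expQuotCoeff n • powFDeriv n (Ck k) (CM L)).col M -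
      (expQuotCoeff n • powFDeriv n (Ck k) (CM M)).col L) (hpow L) (hpow M)
    (by ext i; simp [powFDeriv])
    (fun n => by
      have h0 (j : Fin N) : (expQuotCoeff 0 • Ck k ^ 0).col j = Pi.single j 1 := by
        ext i
        simp [expQuotCoeff, Matrix.one_apply, Pi.single_apply]
      simp only [h0, ← hCk_mulVec, hCk_single, Matrix.mulVec_sub, ← hcol, mul_smul_comm,
        powFDeriv_succ_apply]
      ext i
      simp only [Matrix.col_apply, Matrix.smul_apply, Matrix.add_apply, Pi.smul_apply,
        Pi.neg_apply, Pi.sub_apply, Pi.add_apply, smul_eq_mul]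
      rw [mul_sub, ← mul_assoc, ← mul_assoc, expQuotCoeff_succ]
      ring)
  have hW := (hfderiv A L M).sub (hfderiv A M L)
  rw [← hasSum_nat_add_iff' 1] at hW
  have hR := (hasSum_structureBracket_antidiagonal Cc
    (f := fun n => (expQuotCoeff n • Ck k ^ n).col L)
    (g := fun n => (expQuotCoeff n • Ck k ^ n).col M)
    (u := (Y k).col L) (v := (Y k).col M) (hYsum · L) (hYsum · M) A).neg
  have hterm (n : ℕ) :
      (expQuotCoeff (n + 1) • powFDeriv (n + 1) (Ck k) (CM L)) A M -
        (expQuotCoeff (n + 1) • powFDeriv (n + 1) (Ck k) (CM M)) A L =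
      -∑ p ∈ Finset.HasAntidiagonal.antidiagonal n,
        structureBracket Cc ((expQuotCoeff p.1 • Ck k ^ p.1).col L)
          ((expQuotCoeff p.2 • Ck k ^ p.2).col M) A := by
    have h := congrFun (hcoeff n) A
    rw [Pi.neg_apply, Finset.sum_apply] at h
    exact h
  have heq := hW.unique ((funext hterm).symm ▸ hR)
  simpa [powFDeriv, structureBracket_apply] using heq
end
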